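/- Let Ω ⊂ ℝ² be a compact convex set with nonempty interior and let D_n = (G_n, p_n) be a uniform sequence of good straight-line drawings in Ω with |V(G_n)| = n, and suppose |E(G_n)|/n² → e as n → ∞. Then liminf_{n→∞} cr(D_n)/n⁴ ≥ (8/(9π²))·e³. -/

import Mathlib

open MeasureTheory Filter Real Set
open scoped ENNReal Topology

noncomputable section

abbrev Pl := ℝ × ℝ

/-- Two straight segments cross if their relative interiors (open segments) meet. -/
def PCross (x₁ x₂ x₃ x₄ : Pl) : Prop :=
  (openSegment ℝ x₁ x₂ ∩ openSegment ℝ x₃ x₄).Nonempty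

/-- The uniform probability measure on `Ω` (normalized Lebesgue measure). -/
def unifOn (Ω : Set Pl) : Measure Pl := (volume Ω)⁻¹ • (volume.restrict Ω)

/-- Edge density `e_Ω(w)`. -/
def ePl (Ω : Set Pl) (w : Pl → Pl → ℝ) : ℝ≥0∞ :=
  ∫⁻ y, ∫⁻ z, ENNReal.ofReal (w y z) ∂(unifOn Ω) ∂(unifOn Ω)

open Classical in
/-- Indicator of the planar crossing event. -/
def pCrossInd (x₁ x₂ x₃ x₄ : Pl) : ℝ≥0∞ := if PCross x₁ x₂ x₃ x₄ then 1 else 0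

/-- Crossing functional `Cr_Ω(w)`. -/
def crPl (Ω : Set Pl) (w : Pl → Pl → ℝ) : ℝ≥0∞ :=
  ∫⁻ x₁, ∫⁻ x₂, ∫⁻ x₃, ∫⁻ x₄,
    ENNReal.ofReal (w x₁ x₂) * ENNReal.ofReal (w x₃ x₄) * pCrossInd x₁ x₂ x₃ x₄
      ∂(unifOn Ω) ∂(unifOn Ω) ∂(unifOn Ω) ∂(unifOn Ω)

/-- The drawn straight segments of two edges `e, f` cross. -/
def DrawnCrossPl {V : Type*} (p : V → Pl) (e f : Sym2 V) : Prop :=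
  ∃ u v u' v', u ∈ e ∧ v ∈ e ∧ u ≠ v ∧ u' ∈ f ∧ v' ∈ f ∧ u' ≠ v' ∧
    PCross (p u) (p v) (p u') (p v')

/-- The crossing number of a straight-line drawing: the number of unordered pairs
of distinct edges whose drawn segments cross (ordered pairs counted and halved). -/
def crNumPl {V : Type*} (G : SimpleGraph V) (p : V → Pl) : ℝ :=
  ({q : Sym2 V × Sym2 V |
      q.1 ∈ G.edgeSet ∧ q.2 ∈ G.edgeSet ∧ q.1 ≠ q.2 ∧ DrawnCrossPl p q.1 q.2}.ncard : ℝ) / 2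

lemma continuousAt_sq_div_of_simple_zero {f s : ℝ → ℝ} {f' s' x : ℝ} (hf : HasDerivAt f f' x)
    (hs : HasDerivAt s s' x) (hf0 : f x = 0) (hs0 : s x = 0) (hs' : s' ≠ 0) :
    ContinuousAt (fun y => f y ^ 2 / s y) x := by
  rw [continuousAt_iff_punctured_nhds]
  have h1 : Tendsto (fun y => f y * (slope f x y / slope s x y)) (𝓝[≠] x) (𝓝 (0 * (f' / s'))) := by
    have hc : Tendsto f (𝓝[≠] x) (𝓝 0) := by
      have := hf.continuousAt.tendsto
      rw [hf0] at this
      exact this.mono_left nhdsWithin_le_nhds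
    exact hc.mul ((hasDerivAt_iff_tendsto_slope.1 hf).div (hasDerivAt_iff_tendsto_slope.1 hs) hs')
  simp only [hf0, hs0, div_zero]
  rw [zero_mul] at h1
  refine h1.congr' ?_
  filter_upwards [self_mem_nhdsWithin] with y hy
  have hyx : y - x ≠ 0 := sub_ne_zero.2 hy
  simp only [slope_def_field, hf0, hs0, sub_zero]
  rw [div_div_div_cancel_right₀ hyx]
  ring

/-- Wirtinger's inequality on an interval of length `π`, Dirichlet boundary conditions. -/
lemma wirtinger_dirichlet {G G' : ℝ → ℝ} (hG : ∀ x, HasDerivAt G (G' x) x) (hG' : Continuous G')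
    {a : ℝ} (h0 : G a = 0) (h1 : G (a + π) = 0) :
    ∫ x in a..a + π, G x ^ 2 ≤ ∫ x in a..a + π, G' x ^ 2 := by
  have hGc : Continuous G := continuous_iff_continuousAt.2 fun x => (hG x).continuousAt
  have hs : ∀ x, HasDerivAt (fun x => sin (x - a)) (cos (x - a)) x := fun x => by
    simpa using ((hasDerivAt_id x).sub_const a).sin
  have hco : ∀ x, HasDerivAt (fun x => cos (x - a)) (-sin (x - a)) x := fun x => by
    simpa using ((hasDerivAt_id x).sub_const a).cos
  have hpos : ∀ x ∈ Ioo a (a + π), 0 < sin (x - a) := fun x hx =>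
    sin_pos_of_pos_of_lt_pi (by linarith [hx.1]) (by linarith [hx.2])
  set K : ℝ → ℝ := fun x => G x ^ 2 / sin (x - a) * cos (x - a) with hK
  have hab : a ≤ a + π := by linarith [pi_pos]
  have hKc : ContinuousOn K (Icc a (a + π)) := by
    intro x hx
    refine ContinuousAt.continuousWithinAt ?_
    refine ContinuousAt.mul ?_ (hco x).continuousAt
    rcases eq_or_lt_of_le hx.1 with rfl | hx1
    · exact continuousAt_sq_div_of_simple_zero (hG _) (hs _) h0 (by simp) (by simp)
    rcases eq_or_lt_of_le hx.2 with rfl | hx2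
    · exact continuousAt_sq_div_of_simple_zero (hG _) (hs _) h1 (by simp) (by simp)
    · exact (hGc.continuousAt.pow 2).div (hs x).continuousAt (hpos x ⟨hx1, hx2⟩).ne'
  have key := intervalIntegral.sub_le_integral_of_hasDeriv_right_of_le (g := K)
    (g' := fun x => (2 * G x * G' x * sin (x - a) - G x ^ 2 * cos (x - a)) / sin (x - a) ^ 2
        * cos (x - a) + G x ^ 2 / sin (x - a) * (-sin (x - a)))
    (φ := fun x => G' x ^ 2 - G x ^ 2) hab hKc (fun x hx => by
      have := (((hG x).pow 2).div (hs x) (hpos x hx).ne').mul (hco x)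
      refine HasDerivAt.hasDerivWithinAt (this.congr_deriv ?_)
      simp)
    ((by fun_prop : Continuous fun x => G' x ^ 2 - G x ^ 2).integrableOn_Icc) (fun x hx => by
      have hp := hpos x hx
      have : G' x ^ 2 - G x ^ 2 - ((2 * G x * G' x * sin (x - a) - G x ^ 2 * cos (x - a))
          / sin (x - a) ^ 2 * cos (x - a) + G x ^ 2 / sin (x - a) * (-sin (x - a)))
          = (G' x - G x * cos (x - a) / sin (x - a)) ^ 2 := by
        field_simp
        ring
      nlinarith [sq_nonneg (G' x - G x * cos (x - a) / sin (x - a))])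
  have e1 : K (a + π) = 0 := by simp [hK]
  have e2 : K a = 0 := by simp [hK]
  rw [e1, e2, intervalIntegral.integral_sub (Continuous.intervalIntegrable (by fun_prop) _ _)
    (Continuous.intervalIntegrable (by fun_prop) _ _)] at key
  linarith

/-- An affine isoperimetric inequality for `π`-periodic gauges, in analytic form
(the planar Blaschke–Santaló inequality for origin-symmetric bodies). -/
lemma santalo_periodic {Z Z' : ℝ → ℝ} (hZ : ∀ x, HasDerivAt Z (Z' x) x) (hZ' : Continuous Z')
    (hpos : ∀ x, 0 < Z x) (hper : Function.Periodic Z π) (hper' : Function.Periodic Z' π) :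
    ((∫ x in (0 : ℝ)..π, Z x ^ 2) - ∫ x in (0 : ℝ)..π, Z' x ^ 2) *
      (∫ x in (0 : ℝ)..π, (Z x ^ 2)⁻¹) ≤ π ^ 2 := by
  have hZc : Continuous Z := continuous_iff_continuousAt.2 fun x => (hZ x).continuousAt
  have hZi : Continuous fun x => (Z x ^ 2)⁻¹ :=
    (hZc.pow 2).inv₀ fun x => pow_ne_zero _ (hpos x).ne'
  set J := ∫ x in (0 : ℝ)..π, (Z x ^ 2)⁻¹ with hJ
  have hJpos : 0 < J := intervalIntegral.intervalIntegral_pos_of_pos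
    (hZi.intervalIntegrable _ _) (fun x => by have := hpos x; positivity) pi_pos
  set c := π / J with hc
  have hperi : Function.Periodic (fun x => (Z x ^ 2)⁻¹) π := fun x => by
    simp only [hper x]
  set φ : ℝ → ℝ := fun x => c * ∫ t in (0 : ℝ)..x, (Z t ^ 2)⁻¹ with hφ
  have hφd : ∀ x, HasDerivAt φ (c * (Z x ^ 2)⁻¹) x := fun x =>
    (intervalIntegral.integral_hasDerivAt_right (hZi.intervalIntegrable _ _)
      (hZi.stronglyMeasurableAtFilter _ _) hZi.continuousAt).const_mul c
  have hφc : Continuous φ := continuous_iff_continuousAt.2 fun x => (hφd x).continuousAt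
  have hφπ : ∀ x, φ (x + π) = φ x + π := fun x => by
    simp only [hφ]
    rw [← intervalIntegral.integral_add_adjacent_intervals (hZi.intervalIntegrable 0 x)
      (hZi.intervalIntegrable x (x + π)), hperi.intervalIntegral_add_eq x 0, zero_add,
      ← hJ, mul_add]
    congr 1
    rw [hc]
    field_simp
  have hφ0 : φ 0 = 0 := by simp [hφ]
  have hφ1 : φ π = π := by have := hφπ 0; rwa [hφ0, zero_add] at this
  have hG1 : ∀ x, HasDerivAt (fun x => Z x * sin (φ x))
      (Z' x * sin (φ x) + c * cos (φ x) / Z x) x := fun x => by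
    refine ((hZ x).mul (hφd x).sin).congr_deriv ?_
    have := (hpos x).ne'
    field_simp
  have hG2 : ∀ x, HasDerivAt (fun x => Z x * cos (φ x))
      (Z' x * cos (φ x) - c * sin (φ x) / Z x) x := fun x => by
    refine ((hZ x).mul (hφd x).cos).congr_deriv ?_
    have := (hpos x).ne'
    field_simp
    ring
  have hne : ∀ x, Z x ≠ 0 := fun x => (hpos x).ne'
  have hG1c : Continuous fun x => Z' x * sin (φ x) + c * cos (φ x) / Z x := by
    fun_prop (disch := assumption)
  have hG2c : Continuous fun x => Z' x * cos (φ x) - c * sin (φ x) / Z x := by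
    fun_prop (disch := assumption)
  have hG1s : Continuous fun x => (Z' x * sin (φ x) + c * cos (φ x) / Z x) ^ 2 := hG1c.pow 2
  have hG2s : Continuous fun x => (Z' x * cos (φ x) - c * sin (φ x) / Z x) ^ 2 := hG2c.pow 2
  have w1 := wirtinger_dirichlet hG1 hG1c (a := 0) (by simp [hφ0]) (by simp [hφ1])
  obtain ⟨θ, -, hθ⟩ : π / 2 ∈ φ '' Icc 0 π :=
    intermediate_value_Icc pi_pos.le hφc.continuousOn
      ⟨by rw [hφ0]; positivity, by rw [hφ1]; linarith [pi_pos]⟩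
  have w2 := wirtinger_dirichlet hG2 hG2c (a := θ) (by simp [hθ]) (by simp [hφπ, hθ])
  have p1 : Function.Periodic (fun x => (Z x * cos (φ x)) ^ 2) π := fun x => by
    simp only [hper x, hφπ, cos_add_pi]; ring
  have p2 : Function.Periodic (fun x => (Z' x * cos (φ x) - c * sin (φ x) / Z x) ^ 2) π :=
    fun x => by
      simp only [hper x, hper' x, hφπ, cos_add_pi, sin_add_pi]; ring
  rw [p1.intervalIntegral_add_eq θ 0, p2.intervalIntegral_add_eq θ 0, zero_add] at w2
  rw [zero_add] at w1
  have w := add_le_add w1 w2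
  rw [← intervalIntegral.integral_add (Continuous.intervalIntegrable (by fun_prop) _ _)
      (Continuous.intervalIntegrable (by fun_prop) _ _),
    ← intervalIntegral.integral_add (hG1s.intervalIntegrable _ _)
      (hG2s.intervalIntegrable _ _)] at w
  have e1 : (fun x => (Z x * sin (φ x)) ^ 2 + (Z x * cos (φ x)) ^ 2) = fun x => Z x ^ 2 := by
    ext x
    linear_combination Z x ^ 2 * sin_sq_add_cos_sq (φ x)
  have e2 : (fun x => (Z' x * sin (φ x) + c * cos (φ x) / Z x) ^ 2
      + (Z' x * cos (φ x) - c * sin (φ x) / Z x) ^ 2)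
      = fun x => Z' x ^ 2 + c ^ 2 * (Z x ^ 2)⁻¹ := by
    ext x
    have := hne x
    field_simp
    linear_combination (Z x ^ 2 * Z' x ^ 2 + c ^ 2) * sin_sq_add_cos_sq (φ x)
  rw [e1, e2, intervalIntegral.integral_add (Continuous.intervalIntegrable (by fun_prop) _ _)
    ((hZi.const_mul _).intervalIntegrable _ _), intervalIntegral.integral_const_mul, ← hJ] at w
  calc _ ≤ (c ^ 2 * J) * J := by gcongr; linarith
    _ = π ^ 2 := by rw [hc]; field_simp

/-- The determinant of two planar vectors. -/
def cross (v w : Pl) : ℝ := v.1 * w.2 - v.2 * w.1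

/-- The unit vector with polar angle `θ`. -/
def dir (θ : ℝ) : Pl := (cos θ, sin θ)

/-- The unit vector with polar angle `θ + π / 2`. -/
def dirPerp (θ : ℝ) : Pl := (-sin θ, cos θ)

/-- The derivative in `θ` of `|cross v (dir θ)|`. -/
def absCrossDeriv (v : Pl) (θ : ℝ) : ℝ :=
  cross v (dir θ) * cross v (dirPerp θ) / |cross v (dir θ)|

/-- The support function of the (rotated) centroid body of `ν` in direction `θ`. -/
def centroidGauge (ν : Measure Pl) (θ : ℝ) : ℝ := ∫ v, |cross v (dir θ)| ∂ν

/-- The derivative of `centroidGauge ν`. -/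
def centroidGaugeDeriv (ν : Measure Pl) (θ : ℝ) : ℝ := ∫ v, absCrossDeriv v θ ∂ν

lemma continuous_cross : Continuous fun q : Pl × Pl => cross q.1 q.2 := by
  unfold cross; fun_prop

@[fun_prop]
lemma Continuous.cross {X : Type*} [TopologicalSpace X] {f g : X → Pl} (hf : Continuous f)
    (hg : Continuous g) : Continuous fun x => cross (f x) (g x) :=
  continuous_cross.comp (hf.prodMk hg)

@[fun_prop]
lemma continuous_dir : Continuous dir := by unfold dir; fun_prop

@[fun_prop]
lemma continuous_dirPerp : Continuous dirPerp := by unfold dirPerp; fun_prop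

lemma cross_swap (v w : Pl) : cross w v = -cross v w := by unfold cross; ring

lemma abs_cross_swap (v w : Pl) : |cross w v| = |cross v w| := by rw [cross_swap, abs_neg]

lemma abs_cross_le {v w : Pl} {R S : ℝ} (hv : ‖v‖ ≤ R) (hw : ‖w‖ ≤ S) :
    |cross v w| ≤ 2 * R * S := by
  have h1 : |v.1| ≤ R := (norm_fst_le v).trans hv
  have h2 : |v.2| ≤ R := (norm_snd_le v).trans hv
  have h3 : |w.1| ≤ S := (norm_fst_le w).trans hw
  have h4 : |w.2| ≤ S := (norm_snd_le w).trans hw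
  have hR : 0 ≤ R := (abs_nonneg _).trans h1
  calc |cross v w| ≤ |v.1 * w.2| + |v.2 * w.1| := abs_sub _ _
    _ = |v.1| * |w.2| + |v.2| * |w.1| := by rw [abs_mul, abs_mul]
    _ ≤ R * S + R * S := by gcongr
    _ = _ := by ring

lemma norm_dir_le (θ : ℝ) : ‖dir θ‖ ≤ 1 := by
  simp [dir, Prod.norm_def, abs_cos_le_one, abs_sin_le_one]

lemma norm_dirPerp_le (θ : ℝ) : ‖dirPerp θ‖ ≤ 1 := by
  simp [dirPerp, Prod.norm_def, abs_cos_le_one, abs_sin_le_one]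

lemma dir_add_pi (θ : ℝ) : dir (θ + π) = -dir θ := by simp [dir]

lemma dirPerp_add_pi (θ : ℝ) : dirPerp (θ + π) = -dirPerp θ := by simp [dirPerp]

lemma cross_neg_right (v w : Pl) : cross v (-w) = -cross v w := by
  simp only [cross, Prod.fst_neg, Prod.snd_neg]; ring

lemma abs_absCrossDeriv_le (v : Pl) (θ : ℝ) : |absCrossDeriv v θ| ≤ |cross v (dirPerp θ)| := by
  unfold absCrossDeriv
  rw [abs_div, abs_mul, abs_abs]
  rcases eq_or_ne (cross v (dir θ)) 0 with h | h
  · simp [h]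
  · rw [mul_div_cancel_left₀ _ (abs_ne_zero.2 h)]

lemma hasDerivAt_cross_dir (v : Pl) (θ : ℝ) :
    HasDerivAt (fun θ => cross v (dir θ)) (cross v (dirPerp θ)) θ := by
  simp only [cross, dir, dirPerp]
  exact (((hasDerivAt_sin θ).const_mul v.1).sub ((hasDerivAt_cos θ).const_mul v.2))

lemma hasDerivAt_abs_cross_dir {v : Pl} {θ : ℝ} (h : cross v (dir θ) ≠ 0) :
    HasDerivAt (fun θ => |cross v (dir θ)|) (absCrossDeriv v θ) θ := by
  refine ((hasDerivAt_abs h).comp θ (hasDerivAt_cross_dir v θ)).congr_deriv ?_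
  unfold absCrossDeriv
  rcases h.lt_or_gt with h | h
  · rw [sign_neg h, abs_of_neg h]; simp; field_simp
  · rw [sign_pos h, abs_of_pos h]; simp; field_simp

lemma measurable_absCrossDeriv : Measurable fun q : Pl × ℝ => absCrossDeriv q.1 q.2 := by
  unfold absCrossDeriv
  exact (Continuous.measurable (by fun_prop)).div (Continuous.measurable (by fun_prop))

lemma absCrossDeriv_periodic (v : Pl) : Function.Periodic (absCrossDeriv v) π := fun θ => by
  simp [absCrossDeriv, dir_add_pi, dirPerp_add_pi, cross_neg_right]

lemma centroidGauge_periodic (ν : Measure Pl) : Function.Periodic (centroidGauge ν) π := fun θ => by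
  simp [centroidGauge, dir_add_pi, cross_neg_right]

lemma centroidGaugeDeriv_periodic (ν : Measure Pl) :
    Function.Periodic (centroidGaugeDeriv ν) π := fun θ => by
  simp [centroidGaugeDeriv, absCrossDeriv_periodic _ θ]

section centroidGauge

variable {ν : Measure Pl} [IsFiniteMeasure ν] {R : ℝ}

lemma integrable_abs_cross (hR : ∀ᵐ v ∂ν, ‖v‖ ≤ R) (w : Pl) :
    Integrable (fun v => |cross v w|) ν := by
  refine Integrable.of_bound (Continuous.aestronglyMeasurable (by fun_prop)) (2 * R * ‖w‖) ?_
  filter_upwards [hR] with v hv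
  rw [norm_eq_abs, abs_abs]
  exact abs_cross_le hv le_rfl

lemma hasDerivAt_centroidGauge (hR : ∀ᵐ v ∂ν, ‖v‖ ≤ R)
    (hν : ∀ θ, ∀ᵐ v ∂ν, cross v (dir θ) ≠ 0) (θ : ℝ) :
    HasDerivAt (centroidGauge ν) (centroidGaugeDeriv ν θ) θ := by
  refine (hasDerivAt_integral_of_dominated_loc_of_lip (F := fun θ v => |cross v (dir θ)|)
    (bound := fun _ => 2 * R) (s := univ) univ_mem ?_ (integrable_abs_cross hR _) ?_ ?_
    (integrable_const _) ?_).2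
  · exact Eventually.of_forall fun θ => (integrable_abs_cross hR _).aestronglyMeasurable
  · exact (measurable_absCrossDeriv.comp
      (measurable_id.prodMk measurable_const)).aestronglyMeasurable
  · filter_upwards [hR] with v hv
    have hb : ∀ x, ‖cross v (dirPerp x)‖ ≤ 2 * R := fun x => by
      simpa using abs_cross_le hv (norm_dirPerp_le x)
    have h1 : LipschitzOnWith (Real.nnabs (2 * R)) (fun θ => cross v (dir θ)) univ := by
      refine convex_univ.lipschitzOnWith_of_nnnorm_hasDerivWithin_le
        (f' := fun θ => cross v (dirPerp θ))
        (fun x _ => (hasDerivAt_cross_dir v x).hasDerivWithinAt) fun x _ => ?_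
      rw [← NNReal.coe_le_coe]
      simpa using (hb x).trans (le_abs_self _)
    refine LipschitzOnWith.of_dist_le_mul fun x hx y hy => ?_
    refine (le_trans ?_ (h1.dist_le_mul x hx y hy))
    rw [dist_eq, dist_eq]
    exact abs_abs_sub_abs_le_abs_sub _ _
  · filter_upwards [hν θ] with v hv using hasDerivAt_abs_cross_dir hv

lemma continuous_centroidGaugeDeriv (hR : ∀ᵐ v ∂ν, ‖v‖ ≤ R)
    (hν : ∀ θ, ∀ᵐ v ∂ν, cross v (dir θ) ≠ 0) : Continuous (centroidGaugeDeriv ν) := by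
  refine continuous_iff_continuousAt.2 fun θ => ?_
  refine continuousAt_of_dominated (bound := fun _ => 2 * R) ?_ ?_ (integrable_const _) ?_
  · exact Eventually.of_forall fun θ =>
      (measurable_absCrossDeriv.comp (measurable_id.prodMk measurable_const)).aestronglyMeasurable
  · refine Eventually.of_forall fun x => ?_
    filter_upwards [hR] with v hv
    exact (abs_absCrossDeriv_le v x).trans (by simpa using abs_cross_le hv (norm_dirPerp_le x))
  · filter_upwards [hν θ] with v hv
    unfold absCrossDeriv
    exact ContinuousAt.div (Continuous.continuousAt (by fun_prop))
      (Continuous.continuousAt (by fun_prop)) (abs_ne_zero.2 hv)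

lemma centroidGauge_pos (hν0 : ν ≠ 0) (hR : ∀ᵐ v ∂ν, ‖v‖ ≤ R)
    (hν : ∀ θ, ∀ᵐ v ∂ν, cross v (dir θ) ≠ 0) (θ : ℝ) : 0 < centroidGauge ν θ := by
  unfold centroidGauge
  rw [integral_pos_iff_support_of_nonneg (fun _ => abs_nonneg _) (integrable_abs_cross hR _)]
  have : Function.support (fun v => |cross v (dir θ)|) =ᵐ[ν] univ := by
    rw [eventuallyEq_univ]
    filter_upwards [hν θ] with v hv
    simpa using hv
  rw [measure_congr this]
  exact Measure.measure_univ_pos.2 hν0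

end centroidGauge

lemma exists_polar (v : Pl) : ∃ r : ℝ, 0 ≤ r ∧ ∃ α, v = r • dir α := by
  refine ⟨‖(⟨v.1, v.2⟩ : ℂ)‖, norm_nonneg _, Complex.arg ⟨v.1, v.2⟩, ?_⟩
  exact Prod.ext (by simp [dir]) (by simp [dir])

lemma cross_smul_left (v w : Pl) (r : ℝ) : cross (r • v) w = r * cross v w := by
  simp only [cross, Prod.smul_fst, Prod.smul_snd, smul_eq_mul]; ring

lemma cross_dir_dir (α θ : ℝ) : cross (dir α) (dir θ) = sin (θ - α) := by
  simp only [cross, dir, sin_sub]; ring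

lemma cross_dir_dirPerp (α θ : ℝ) : cross (dir α) (dirPerp θ) = cos (θ - α) := by
  simp only [cross, dir, dirPerp, cos_sub]; ring

/-- Integration by parts of a `π`-periodic `C¹` function against the fundamental solution
`|sin|` of `Z'' + Z` on the circle of length `π`. -/
lemma integral_absCross_mul_sub {Z Z' : ℝ → ℝ} (hZ : ∀ x, HasDerivAt Z (Z' x) x)
    (hZ' : Continuous Z') (hper : Function.Periodic Z π) (hper' : Function.Periodic Z' π)
    {r : ℝ} (hr : 0 ≤ r) (α : ℝ) :
    ∫ θ in (0 : ℝ)..π, (|cross (r • dir α) (dir θ)| * Z θ - absCrossDeriv (r • dir α) θ * Z' θ)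
      = 2 * (r * Z α) := by
  have hZc : Continuous Z := continuous_iff_continuousAt.2 fun x => (hZ x).continuousAt
  have hp : Function.Periodic (fun θ => |cross (r • dir α) (dir θ)| * Z θ
      - absCrossDeriv (r • dir α) θ * Z' θ) π := fun θ => by
    simp [absCrossDeriv_periodic _ θ, hper θ, hper' θ, dir_add_pi, cross_neg_right]
  have hshift := hp.intervalIntegral_add_eq α 0
  rw [zero_add] at hshift
  rw [← hshift]
  have hle : α ≤ α + π := by linarith [pi_pos]
  have hF : ∀ θ, HasDerivAt (fun θ => -(r * cos (θ - α) * Z θ))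
      (r * sin (θ - α) * Z θ - r * cos (θ - α) * Z' θ) θ := fun θ => by
    have hco : HasDerivAt (fun x => cos (x - α)) (-sin (θ - α)) θ := by
      simpa using ((hasDerivAt_id θ).sub_const α).cos
    refine (((hco.const_mul r).mul (hZ θ)).neg).congr_deriv ?_
    ring
  have : ∫ θ in α..α + π, (|cross (r • dir α) (dir θ)| * Z θ - absCrossDeriv (r • dir α) θ * Z' θ)
      = ∫ θ in α..α + π, (r * sin (θ - α) * Z θ - r * cos (θ - α) * Z' θ) := by
    rw [intervalIntegral.integral_of_le hle, intervalIntegral.integral_of_le hle,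
      integral_Ioc_eq_integral_Ioo, integral_Ioc_eq_integral_Ioo]
    refine setIntegral_congr_fun measurableSet_Ioo fun θ hθ => ?_
    have hs : 0 < sin (θ - α) :=
      sin_pos_of_pos_of_lt_pi (by linarith [hθ.1]) (by linarith [hθ.2])
    simp only [absCrossDeriv, cross_smul_left, cross_dir_dir, cross_dir_dirPerp]
    rw [abs_of_nonneg (mul_nonneg hr hs.le)]
    rcases hr.eq_or_lt with rfl | hr
    · simp
    · field_simp
  rw [this, intervalIntegral.integral_eq_sub_of_hasDerivAt (fun θ _ => hF θ)
    (Continuous.intervalIntegrable (by fun_prop) _ _), hper α]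
  simp
  ring

section centroidGauge

variable {ν : Measure Pl} [IsFiniteMeasure ν] {R : ℝ}

/-- The area formula for the centroid body. -/
lemma integral_centroidGauge_sq_sub (hR : ∀ᵐ v ∂ν, ‖v‖ ≤ R)
    (hν : ∀ θ, ∀ᵐ v ∂ν, cross v (dir θ) ≠ 0) :
    (∫ θ in (0 : ℝ)..π, centroidGauge ν θ ^ 2) - (∫ θ in (0 : ℝ)..π, centroidGaugeDeriv ν θ ^ 2)
      = 2 * ∫ v, ∫ w, |cross v w| ∂ν ∂ν := by
  have hZ := hasDerivAt_centroidGauge hR hν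
  have hZ' := continuous_centroidGaugeDeriv hR hν
  have hZc : Continuous (centroidGauge ν) :=
    continuous_iff_continuousAt.2 fun x => (hZ x).continuousAt
  rw [← intervalIntegral.integral_sub (Continuous.intervalIntegrable (by fun_prop) _ _)
    (Continuous.intervalIntegrable (by fun_prop) _ _)]
  have hder : ∀ θ, Integrable (fun v => absCrossDeriv v θ) ν := fun θ => by
    refine Integrable.of_bound (measurable_absCrossDeriv.comp
      (measurable_id.prodMk measurable_const)).aestronglyMeasurable (2 * R * 1) ?_
    filter_upwards [hR] with v hv
    exact (abs_absCrossDeriv_le v θ).trans (abs_cross_le hv (norm_dirPerp_le θ))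
  have e1 : ∀ θ, centroidGauge ν θ ^ 2 - centroidGaugeDeriv ν θ ^ 2
      = ∫ v, (|cross v (dir θ)| * centroidGauge ν θ
          - absCrossDeriv v θ * centroidGaugeDeriv ν θ) ∂ν := fun θ => by
    rw [integral_sub ((integrable_abs_cross hR _).mul_const _) ((hder θ).mul_const _),
      integral_mul_const, integral_mul_const, sq, sq]
    rfl
  simp only [e1]
  rw [intervalIntegral_integral_swap, ← integral_const_mul]
  · refine integral_congr_ae (Eventually.of_forall fun v => ?_)
    obtain ⟨r, hr, α, rfl⟩ := exists_polar v
    simp only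
    rw [integral_absCross_mul_sub hZ hZ' (centroidGauge_periodic ν)
      (centroidGaugeDeriv_periodic ν) hr,
      centroidGauge, ← integral_const_mul]
    congr 2
    ext w
    rw [cross_smul_left, abs_mul, abs_of_nonneg hr, abs_cross_swap]
  · obtain ⟨C, hC⟩ := (isCompact_Icc (a := (0 : ℝ)) (b := π)).exists_bound_of_continuousOn
      hZc.continuousOn
    obtain ⟨C', hC'⟩ := (isCompact_Icc (a := (0 : ℝ)) (b := π)).exists_bound_of_continuousOn
      hZ'.continuousOn
    have : IsFiniteMeasure (volume.restrict (uIoc 0 π)) := by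
      rw [uIoc_of_le pi_pos.le]
      infer_instance
    refine Integrable.of_bound (Measurable.aestronglyMeasurable ?_)
      (2 * R * 1 * C + 2 * R * 1 * C') ?_
    · refine Measurable.sub (Continuous.measurable (by fun_prop)) ?_
      exact (measurable_absCrossDeriv.comp measurable_swap).mul
        (hZ'.measurable.comp measurable_fst)
    · have hI : ∀ᵐ θ ∂(volume.restrict (uIoc 0 π)), θ ∈ Icc 0 π := by
        filter_upwards [ae_restrict_mem measurableSet_uIoc] with θ hθ
        rw [uIoc_of_le pi_pos.le] at hθ
        exact Ioc_subset_Icc_self hθ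
      filter_upwards [Measure.quasiMeasurePreserving_fst.ae hI,
        Measure.quasiMeasurePreserving_snd.ae hR] with q h1 h2
      have b1 := abs_cross_le h2 (norm_dir_le q.1)
      have b2 := (abs_absCrossDeriv_le q.2 q.1).trans (abs_cross_le h2 (norm_dirPerp_le q.1))
      have hR0 : 0 ≤ 2 * R * 1 := (abs_nonneg _).trans b1
      refine (norm_sub_le _ _).trans (add_le_add ?_ ?_)
      · rw [norm_mul, norm_eq_abs, abs_abs]
        exact mul_le_mul b1 (hC _ h1) (norm_nonneg _) hR0
      · rw [norm_mul]
        exact mul_le_mul b2 (hC' _ h1) (norm_nonneg _) hR0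

/-- The planar Blaschke–Santaló inequality for the centroid body of `ν`. -/
lemma santalo_centroidGauge (hν0 : ν ≠ 0) (hR : ∀ᵐ v ∂ν, ‖v‖ ≤ R)
    (hν : ∀ θ, ∀ᵐ v ∂ν, cross v (dir θ) ≠ 0) :
    2 * (∫ v, ∫ w, |cross v w| ∂ν ∂ν) * (∫ θ in (0 : ℝ)..π, (centroidGauge ν θ ^ 2)⁻¹) ≤ π ^ 2 := by
  rw [← integral_centroidGauge_sq_sub hR hν]
  exact santalo_periodic (hasDerivAt_centroidGauge hR hν) (continuous_centroidGaugeDeriv hR hν)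
    (centroidGauge_pos hν0 hR hν) (centroidGauge_periodic ν) (centroidGaugeDeriv_periodic ν)

end centroidGauge

lemma lintegral_Ioi_mul_sub {s z : ℝ} (hs : 0 ≤ s) (hz : 0 < z) :
    ∫⁻ r in Ioi (0 : ℝ), ENNReal.ofReal r * ENNReal.ofReal (s - r * z)
      = ENNReal.ofReal (s ^ 3 / 6 * (z ^ 2)⁻¹) := by
  have hsz : 0 ≤ s / z := by positivity
  have h1 : ∫⁻ r in Ioi (0 : ℝ), ENNReal.ofReal r * ENNReal.ofReal (s - r * z)
      = ∫⁻ r in Ioc 0 (s / z), ENNReal.ofReal (r * (s - r * z)) := by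
    rw [← lintegral_indicator measurableSet_Ioi, ← lintegral_indicator measurableSet_Ioc]
    refine lintegral_congr fun r => ?_
    by_cases h0 : 0 < r
    · by_cases hr : r ≤ s / z
      · rw [indicator_of_mem (mem_Ioi.2 h0), indicator_of_mem (mem_Ioc.2 ⟨h0, hr⟩),
          ENNReal.ofReal_mul h0.le]
      · rw [indicator_of_mem (mem_Ioi.2 h0), indicator_of_notMem (fun h => hr h.2)]
        rw [not_le, div_lt_iff₀ hz] at hr
        rw [ENNReal.ofReal_of_nonpos (by linarith : s - r * z ≤ 0), mul_zero]
    · rw [indicator_of_notMem (fun h : r ∈ Ioi 0 => h0 h), indicator_of_notMem (fun h => h0 h.1)]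
  rw [h1, ← ofReal_integral_eq_lintegral_ofReal]
  · congr 1
    rw [← intervalIntegral.integral_of_le hsz]
    have : ∀ r : ℝ, r * (s - r * z) = s * r - z * r ^ 2 := fun r => by ring
    simp only [this]
    rw [intervalIntegral.integral_sub (Continuous.intervalIntegrable (by fun_prop) _ _)
      (Continuous.intervalIntegrable (by fun_prop) _ _), intervalIntegral.integral_const_mul,
      intervalIntegral.integral_const_mul, integral_id, integral_pow]
    have hz' := hz.ne'
    norm_num
    field_simp
    ring
  · exact ((by fun_prop : Continuous fun r : ℝ => r * (s - r * z)).integrableOn_Icc).mono_set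
      Ioc_subset_Icc_self
  · filter_upwards [ae_restrict_mem measurableSet_Ioc] with r hr
    have := (le_div_iff₀ hz).1 hr.2
    exact mul_nonneg hr.1.le (by linarith)

/-- The volume below height `s` of a gauge given in polar coordinates. -/
lemma lintegral_sub_gauge {N : Pl → ℝ} {Z : ℝ → ℝ} (hNc : Continuous N) (hZc : Continuous Z)
    (hZ : ∀ θ, 0 < Z θ) (hper : Function.Periodic Z π)
    (hN : ∀ r, 0 ≤ r → ∀ θ, N (r • dir θ) = r * Z θ) {s : ℝ} (hs : 0 ≤ s) :
    ∫⁻ v, ENNReal.ofReal (s - N v)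
      = ENNReal.ofReal (s ^ 3 / 3 * ∫ θ in (0 : ℝ)..π, (Z θ ^ 2)⁻¹) := by
  have hZi : Continuous fun x => (Z x ^ 2)⁻¹ :=
    (hZc.pow 2).inv₀ fun x => pow_ne_zero _ (hZ x).ne'
  rw [← lintegral_comp_polarCoord_symm, polarCoord_target, Measure.volume_eq_prod,
    ← Measure.prod_restrict]
  have e1 : ∀ q : ℝ × ℝ, polarCoord.symm q = q.1 • dir q.2 := fun q => by
    simp [polarCoord_symm_apply, dir]
  have hm : Measurable fun q : ℝ × ℝ =>
      ENNReal.ofReal q.1 • ENNReal.ofReal (s - N (polarCoord.symm q)) := by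
    simp only [e1]
    exact (ENNReal.measurable_ofReal.comp measurable_fst).smul
      (ENNReal.measurable_ofReal.comp (Continuous.measurable (by fun_prop)))
  rw [lintegral_prod_symm' _ hm]
  have e2 : ∀ θ, ∫⁻ r in Ioi (0 : ℝ),
      ENNReal.ofReal r • ENNReal.ofReal (s - N (polarCoord.symm (r, θ)))
      = ENNReal.ofReal (s ^ 3 / 6 * (Z θ ^ 2)⁻¹) := fun θ => by
    rw [← lintegral_Ioi_mul_sub hs (hZ θ)]
    refine setLIntegral_congr_fun measurableSet_Ioi fun r hr => ?_
    simp only [e1, smul_eq_mul, hN r (le_of_lt hr) θ]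
  simp only [e2]
  rw [← ofReal_integral_eq_lintegral_ofReal]
  · congr 1
    rw [← integral_Ioc_eq_integral_Ioo, ← intervalIntegral.integral_of_le (by linarith [pi_pos]),
      intervalIntegral.integral_const_mul,
      ← intervalIntegral.integral_add_adjacent_intervals (hZi.intervalIntegrable (-π) 0)
      (hZi.intervalIntegrable 0 π)]
    have hp : Function.Periodic (fun x => (Z x ^ 2)⁻¹) π := fun x => by simp only [hper x]
    have := hp.intervalIntegral_add_eq (-π) 0
    rw [neg_add_cancel, zero_add] at this
    rw [this]
    ring
  · exact (Continuous.integrableOn_Icc (by fun_prop)).mono_set Ioo_subset_Icc_self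
  · exact Eventually.of_forall fun θ => by positivity

lemma ae_cross_dir_ne_zero (θ : ℝ) : ∀ᵐ v : Pl, cross v (dir θ) ≠ 0 := by
  let f : Pl →ₗ[ℝ] ℝ := sin θ • LinearMap.fst ℝ ℝ ℝ - cos θ • LinearMap.snd ℝ ℝ ℝ
  have hf : ∀ v, f v = cross v (dir θ) := fun v => by
    simp [f, cross, dir]; ring
  have hker : LinearMap.ker f ≠ ⊤ := fun h => by
    have h1 : ((sin θ, -cos θ) : Pl) ∈ LinearMap.ker f := by rw [h]; trivial
    rw [LinearMap.mem_ker, hf] at h1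
    simp only [cross, dir] at h1
    nlinarith [sin_sq_add_cos_sq θ]
  have := Measure.addHaar_submodule (volume : Measure Pl) _ hker
  rw [ae_iff]
  convert this using 2
  ext v
  simp [hf]

lemma integral_le_toReal_lintegral_ofReal {α : Type*} [MeasurableSpace α] {μ : Measure α}
    {f : α → ℝ} (hf : Integrable f μ) : ∫ x, f x ∂μ ≤ (∫⁻ x, ENNReal.ofReal (f x) ∂μ).toReal := by
  rw [integral_eq_lintegral_pos_part_sub_lintegral_neg_part hf]
  exact sub_le_self _ ENNReal.toReal_nonneg

/-- Busemann's random simplex inequality in the plane, for measures of density at most one. -/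
theorem busemann_plane {ν : Measure Pl} [IsFiniteMeasure ν] {R : ℝ} (hle : ν ≤ volume)
    (hR : ∀ᵐ v ∂ν, ‖v‖ ≤ R) :
    8 / (9 * π ^ 2) * ν.real univ ^ 3 ≤ ∫ v, ∫ w, |cross v w| ∂ν ∂ν := by
  rcases eq_or_ne ν 0 with rfl | hν0
  · simp
  have hν : ∀ θ, ∀ᵐ v ∂ν, cross v (dir θ) ≠ 0 := fun θ =>
    (Measure.absolutelyContinuous_of_le hle).ae_le (ae_cross_dir_ne_zero θ)
  have hsan := santalo_centroidGauge hν0 hR hν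
  set I := ∫ v, ∫ w, |cross v w| ∂ν ∂ν with hI
  set J := ∫ θ in (0 : ℝ)..π, (centroidGauge ν θ ^ 2)⁻¹ with hJ
  set M := ν.real univ with hM
  have hI0 : 0 ≤ I := integral_nonneg fun _ => integral_nonneg fun _ => abs_nonneg _
  have hM0 : 0 < M := by
    rw [hM, measureReal_def]
    exact ENNReal.toReal_pos (Measure.measure_univ_ne_zero.2 hν0) (measure_ne_top _ _)
  have hZ := hasDerivAt_centroidGauge hR hν
  have hZc : Continuous (centroidGauge ν) :=
    continuous_iff_continuousAt.2 fun x => (hZ x).continuousAt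
  have hZpos := centroidGauge_pos hν0 hR hν
  have hJ0 : 0 < J := intervalIntegral.intervalIntegral_pos_of_pos
    (Continuous.intervalIntegrable ((hZc.pow 2).inv₀ fun x => pow_ne_zero _ (hZpos x).ne') _ _)
    (fun x => by have := hZpos x; positivity) pi_pos
  have hNc : Continuous fun v => ∫ w, |cross v w| ∂ν := by
    refine continuous_iff_continuousAt.2 fun v => ?_
    refine continuousAt_of_dominated (bound := fun _ => 2 * (‖v‖ + 1) * R) ?_ ?_
      (integrable_const _) ?_
    · exact Eventually.of_forall fun v => Continuous.aestronglyMeasurable (by fun_prop)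
    · have : ∀ᶠ x in 𝓝 v, ‖x‖ < ‖v‖ + 1 :=
        continuous_norm.continuousAt.eventually (gt_mem_nhds (by simp))
      filter_upwards [this] with x hx
      filter_upwards [hR] with w hw
      rw [norm_eq_abs, abs_abs]
      exact abs_cross_le hx.le hw
    · exact Eventually.of_forall fun w => Continuous.continuousAt (by fun_prop)
  have hNpol : ∀ r, 0 ≤ r → ∀ θ, ∫ w, |cross (r • dir θ) w| ∂ν = r * centroidGauge ν θ :=
    fun r hr θ => by
      rw [centroidGauge, ← integral_const_mul]
      congr 1
      ext w
      rw [cross_smul_left, abs_mul, abs_of_nonneg hr, abs_cross_swap]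
  have hNi : Integrable (fun v => ∫ w, |cross v w| ∂ν) ν := by
    refine Integrable.of_bound hNc.aestronglyMeasurable (2 * R * R * M) ?_
    filter_upwards [hR] with v hv
    refine norm_integral_le_of_norm_le_const ?_
    filter_upwards [hR] with w hw
    rw [norm_eq_abs, abs_abs]
    exact abs_cross_le hv hw
  have bath : ∀ s, 0 ≤ s → s * M - I ≤ s ^ 3 / 3 * J := fun s hs => by
    have h1 : s * M - I = ∫ v, (s - ∫ w, |cross v w| ∂ν) ∂ν := by
      rw [integral_sub (integrable_const _) hNi, integral_const, smul_eq_mul, mul_comm]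
    have h2 := lintegral_sub_gauge hNc hZc hZpos (centroidGauge_periodic ν) hNpol hs
    rw [h1]
    refine (integral_le_toReal_lintegral_ofReal ((integrable_const _).sub hNi)).trans ?_
    rw [← ENNReal.toReal_ofReal (by positivity : 0 ≤ s ^ 3 / 3 * J), ← h2]
    exact ENNReal.toReal_mono (by rw [h2]; exact ENNReal.ofReal_ne_top) (lintegral_mono' hle le_rfl)
  set s := √(M / J) with hs
  have hs2 : s ^ 2 = M / J := sq_sqrt (by positivity)
  have hs0 : 0 ≤ s := sqrt_nonneg _
  have hb := bath s hs0
  have h3 : 2 / 3 * (s * M) ≤ I := by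
    have : s ^ 3 / 3 * J = s * M / 3 := by
      rw [pow_succ, hs2]; field_simp
    linarith
  have h4 : 4 / 9 * M ^ 3 ≤ I ^ 2 * J := by
    have : (2 / 3 * (s * M)) ^ 2 ≤ I ^ 2 := by gcongr
    calc 4 / 9 * M ^ 3 = (2 / 3 * (s * M)) ^ 2 * J := by
          rw [mul_pow, mul_pow, hs2]; field_simp; ring
      _ ≤ _ := by gcongr
  have h5 : 4 / 9 * M ^ 3 ≤ I * (π ^ 2 / 2) := by
    refine h4.trans ?_
    nlinarith
  rw [div_mul_eq_mul_div, div_le_iff₀ (by positivity)]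
  linarith

lemma busemann_plane_lintegral {ν : Measure Pl} {c : ℝ≥0∞} (hc : c ≠ ⊤) {R : ℝ}
    (hle : ν ≤ c • volume) (hR : ∀ᵐ v ∂ν, ‖v‖ ≤ R) :
    ENNReal.ofReal (8 / (9 * π ^ 2)) * ν univ ^ 3 ≤ c * ∫⁻ v, ∫⁻ w, ‖cross v w‖ₑ ∂ν ∂ν := by
  rcases eq_or_ne c 0 with rfl | hc0
  · have : ν = 0 := le_antisymm (by simpa using hle) (Measure.zero_le _)
    simp [this]
  have hfin : ν univ < ⊤ := by
    have h1 : ν univ ≤ ν (Metric.closedBall 0 R) := by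
      rw [← measure_inter_conull (s := univ) (t := Metric.closedBall 0 R)]
      · simp
      · rw [ae_iff] at hR
        convert hR using 2
        ext; simp
    refine h1.trans_lt ((hle _).trans_lt ?_)
    exact ENNReal.mul_lt_top hc.lt_top measure_closedBall_lt_top
  have hν' : IsFiniteMeasure (c⁻¹ • ν) := ⟨by
    simpa using ENNReal.mul_lt_top (ENNReal.inv_lt_top.2 (pos_iff_ne_zero.2 hc0)) hfin⟩
  have hle' : c⁻¹ • ν ≤ volume := by
    intro s
    have := hle s
    simp only [Measure.smul_apply, smul_eq_mul] at this ⊢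
    rw [mul_comm, ← div_eq_mul_inv]
    exact ENNReal.div_le_of_le_mul' this
  have hcm : c⁻¹ * c = 1 := ENNReal.inv_mul_cancel hc0 hc
  have hcm' : c * c⁻¹ = 1 := ENNReal.mul_inv_cancel hc0 hc
  have key := busemann_plane hle' (Measure.ae_smul_measure hR _)
  have h2 : ENNReal.ofReal (∫ v, ∫ w, |cross v w| ∂(c⁻¹ • ν) ∂(c⁻¹ • ν))
      ≤ c⁻¹ * (c⁻¹ * ∫⁻ v, ∫⁻ w, ‖cross v w‖ₑ ∂ν ∂ν) := by
    rw [← enorm_of_nonneg (integral_nonneg fun _ => integral_nonneg fun _ => abs_nonneg _)]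
    refine (enorm_integral_le_lintegral_enorm _).trans ?_
    rw [lintegral_smul_measure, ← lintegral_const_mul' _ _ (ENNReal.inv_ne_top.2 hc0), smul_eq_mul]
    gcongr with v
    refine (enorm_integral_le_lintegral_enorm _).trans ?_
    rw [lintegral_smul_measure, smul_eq_mul]
    simp
  have h1 : ENNReal.ofReal (8 / (9 * π ^ 2)) * (c⁻¹ * ν univ) ^ 3
      ≤ ENNReal.ofReal (∫ v, ∫ w, |cross v w| ∂(c⁻¹ • ν) ∂(c⁻¹ • ν)) := by
    refine le_trans (le_of_eq ?_) (ENNReal.ofReal_le_ofReal key)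
    rw [ENNReal.ofReal_mul (by positivity), ENNReal.ofReal_pow (measureReal_nonneg),
      ofReal_measureReal]
    simp
  calc ENNReal.ofReal (8 / (9 * π ^ 2)) * ν univ ^ 3
      = c ^ 3 * (ENNReal.ofReal (8 / (9 * π ^ 2)) * (c⁻¹ * ν univ) ^ 3) := by
        rw [mul_pow, mul_left_comm, ← mul_assoc (c ^ 3), ← mul_pow, hcm', one_pow, one_mul]
    _ ≤ c ^ 3 * (c⁻¹ * (c⁻¹ * ∫⁻ v, ∫⁻ w, ‖cross v w‖ₑ ∂ν ∂ν)) := by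
        exact mul_le_mul' le_rfl (h1.trans h2)
    _ = c * (c * c⁻¹) * (c * c⁻¹) * ∫⁻ v, ∫⁻ w, ‖cross v w‖ₑ ∂ν ∂ν := by ring
    _ = _ := by rw [hcm']; ring

lemma lintegral_eq_enorm_cross_mul {v w : Pl} (h : cross v w ≠ 0) {f : Pl → ℝ≥0∞}
    (hf : Measurable f) :
    ∫⁻ z, f z = ‖cross v w‖ₑ * ∫⁻ t : ℝ × ℝ, f (t.1 • v - t.2 • w) := by
  let L : Pl →ₗ[ℝ] Pl := Matrix.toLin (Module.Basis.finTwoProd ℝ) (Module.Basis.finTwoProd ℝ)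
    !![v.1, -w.1; v.2, -w.2]
  have hL : ∀ t : ℝ × ℝ, L t = t.1 • v - t.2 • w := fun t => by
    simp only [L, Matrix.toLin_finTwoProd_apply]
    ext <;> simp <;> ring
  have hdet : LinearMap.det L = -cross v w := by
    simp only [L, LinearMap.det_toLin, Matrix.det_fin_two_of, cross]
    ring
  have hdet0 : LinearMap.det L ≠ 0 := by rw [hdet]; exact neg_ne_zero.2 h
  have hLm : Measurable L := L.continuous_of_finiteDimensional.measurable
  have := Measure.map_linearMap_addHaar_eq_smul_addHaar (volume : Measure Pl) hdet0
  have h2 := congrArg (fun μ => ∫⁻ z, f z ∂μ) this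
  simp only [lintegral_smul_measure, smul_eq_mul] at h2
  rw [lintegral_map hf hLm] at h2
  simp only [hL] at h2
  rw [h2, ← mul_assoc, hdet, ← Real.enorm_eq_ofReal_abs, ← enorm_mul]
  have : cross v w * (-cross v w)⁻¹ = -1 := by field_simp
  rw [this]
  simp

lemma lintegral_shear {F : Pl × Pl → ℝ≥0∞} (hF : Measurable F) :
    ∫⁻ q, F q = ∫⁻ v, ∫⁻ y, F (y, y + v) := by
  rw [lintegral_lintegral_swap (by fun_prop), Measure.volume_eq_prod,
    lintegral_prod _ hF.aemeasurable]
  refine lintegral_congr fun y => ?_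
  exact (lintegral_add_left_eq_self (μ := volume) (fun z => F (y, z)) y).symm

/-- Pairs of segments that cross transversally at interior points, as an open condition. -/
def transversalCrossing : Set ((Pl × Pl) × (Pl × Pl)) :=
  {q | 0 < cross (q.2.1 - q.1.1) (q.2.2 - q.2.1) * cross (q.1.2 - q.1.1) (q.2.2 - q.2.1) ∧
    cross (q.2.1 - q.1.1) (q.2.2 - q.2.1) * cross (q.1.2 - q.1.1) (q.2.2 - q.2.1) <
      cross (q.1.2 - q.1.1) (q.2.2 - q.2.1) ^ 2 ∧
    0 < cross (q.2.1 - q.1.1) (q.1.2 - q.1.1) * cross (q.1.2 - q.1.1) (q.2.2 - q.2.1) ∧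
    cross (q.2.1 - q.1.1) (q.1.2 - q.1.1) * cross (q.1.2 - q.1.1) (q.2.2 - q.2.1) <
      cross (q.1.2 - q.1.1) (q.2.2 - q.2.1) ^ 2}

lemma isOpen_transversalCrossing : IsOpen transversalCrossing := by
  unfold transversalCrossing
  refine (isOpen_lt ?_ ?_).and ((isOpen_lt ?_ ?_).and ((isOpen_lt ?_ ?_).and (isOpen_lt ?_ ?_)))
    <;> fun_prop

lemma mem_transversalCrossing_iff {y v w : Pl} {t : ℝ × ℝ} (h : cross v w ≠ 0) :
    ((y, y + v), (y + (t.1 • v - t.2 • w), y + (t.1 • v - t.2 • w) + w)) ∈ transversalCrossing ↔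
      t ∈ Ioo (0 : ℝ) 1 ×ˢ Ioo (0 : ℝ) 1 := by
  have e1 : cross (t.1 • v - t.2 • w) w = t.1 * cross v w := by simp [cross]; ring
  have e2 : cross (t.1 • v - t.2 • w) v = t.2 * cross v w := by simp [cross]; ring
  have hp : 0 < cross v w ^ 2 := by positivity
  simp only [transversalCrossing, mem_ofPred_eq, add_sub_cancel_left, e1, e2, mem_prod, mem_Ioo]
  have e3 : ∀ s : ℝ, s * cross v w * cross v w = s * cross v w ^ 2 := fun s => by ring
  simp only [e3, mul_pos_iff_of_pos_right hp, mul_lt_iff_lt_one_left hp]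
  tauto

/-- For a density `W` on segments `[y, z]`, the density at `x` of segment vectors `v` of segments
through `x`. -/
def throughDensity (W : Pl × Pl → ℝ≥0∞) (x v : Pl) : ℝ≥0∞ :=
  ∫⁻ t in Ioo (0 : ℝ) 1, W (x - t • v, x - t • v + v)

section throughDensity

variable {W : Pl × Pl → ℝ≥0∞}

lemma measurable_throughDensity (hW : Measurable W) :
    Measurable fun q : Pl × Pl => throughDensity W q.1 q.2 := by
  unfold throughDensity
  exact Measurable.lintegral_prod_right' (f := fun q : (Pl × Pl) × ℝ =>
    W (q.1.1 - q.2 • q.1.2, q.1.1 - q.2 • q.1.2 + q.1.2)) (by fun_prop)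

lemma lintegral_throughDensity (hW : Measurable W) :
    ∫⁻ x, ∫⁻ v, throughDensity W x v = ∫⁻ q, W q := by
  have hm := measurable_throughDensity hW
  rw [lintegral_lintegral_swap hm.aemeasurable, lintegral_shear hW]
  refine lintegral_congr fun v => ?_
  unfold throughDensity
  rw [lintegral_lintegral_swap]
  · have : ∀ t : ℝ, ∫⁻ x, W (x - t • v, x - t • v + v) = ∫⁻ y, W (y, y + v) := fun t =>
      lintegral_sub_right_eq_self (μ := volume) (fun y => W (y, y + v)) (t • v)
    simp [this]
  · exact Measurable.aemeasurable (by fun_prop)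

/-- The crossing measure of segments with fixed vectors `v` and `w`. -/
lemma lintegral_crossing_of_vectors (hW : Measurable W) (v w : Pl) :
    ‖cross v w‖ₑ * ∫⁻ x, throughDensity W x v * throughDensity W x w
      ≤ ∫⁻ y, ∫⁻ z, transversalCrossing.indicator (fun q => W q.1 * W q.2)
          ((y, y + v), (z, z + w)) := by
  rcases eq_or_ne (cross v w) 0 with h | h
  · simp [h]
  have hO := isOpen_transversalCrossing.measurableSet
  have hind : Measurable (transversalCrossing.indicator (fun q => W q.1 * W q.2)) :=
    Measurable.indicator (by fun_prop) hO
  have hS : MeasurableSet (Ioo (0 : ℝ) 1 ×ˢ Ioo (0 : ℝ) 1) :=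
    measurableSet_Ioo.prod measurableSet_Ioo
  have e1 : ∀ y, ∫⁻ z, transversalCrossing.indicator (fun q => W q.1 * W q.2)
      ((y, y + v), (z, z + w)) = ‖cross v w‖ₑ * ∫⁻ t in Ioo (0 : ℝ) 1 ×ˢ Ioo (0 : ℝ) 1,
        W (y, y + v) * W (y + (t.1 • v - t.2 • w), y + (t.1 • v - t.2 • w) + w) := fun y => by
    rw [← lintegral_add_left_eq_self _ y, lintegral_eq_enorm_cross_mul h (by fun_prop),
      ← lintegral_indicator hS]
    congr 1
    refine lintegral_congr fun t => ?_
    by_cases ht : t ∈ Ioo (0 : ℝ) 1 ×ˢ Ioo (0 : ℝ) 1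
    · rw [indicator_of_mem ht, indicator_of_mem ((mem_transversalCrossing_iff h).2 ht)]
    · rw [indicator_of_notMem ht,
        indicator_of_notMem (fun h' => ht ((mem_transversalCrossing_iff h).1 h'))]
  simp only [e1]
  rw [lintegral_const_mul' _ _ enorm_ne_top]
  refine mul_le_mul' le_rfl ?_
  have swap₁ : ∫⁻ y, ∫⁻ t in Ioo (0 : ℝ) 1 ×ˢ Ioo (0 : ℝ) 1,
        W (y, y + v) * W (y + (t.1 • v - t.2 • w), y + (t.1 • v - t.2 • w) + w)
      = ∫⁻ t in Ioo (0 : ℝ) 1 ×ˢ Ioo (0 : ℝ) 1, ∫⁻ y,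
        W (y, y + v) * W (y + (t.1 • v - t.2 • w), y + (t.1 • v - t.2 • w) + w) :=
    lintegral_lintegral_swap (Measurable.aemeasurable (by fun_prop))
  rw [swap₁]
  have e2 : ∀ t : ℝ × ℝ, ∫⁻ y, W (y, y + v) *
      W (y + (t.1 • v - t.2 • w), y + (t.1 • v - t.2 • w) + w)
      = ∫⁻ x, W (x - t.1 • v, x - t.1 • v + v) * W (x - t.2 • w, x - t.2 • w + w) := fun t => by
    rw [← lintegral_sub_right_eq_self (μ := volume) _ (t.1 • v)]
    refine lintegral_congr fun x => ?_
    have : x - t.1 • v + (t.1 • v - t.2 • w) = x - t.2 • w := by abel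
    rw [this]
  simp only [e2]
  rw [← lintegral_lintegral_swap (Measurable.aemeasurable (by fun_prop))]
  refine lintegral_mono fun x => le_of_eq ?_
  simp only [throughDensity]
  rw [Measure.volume_eq_prod, ← Measure.prod_restrict]
  exact (lintegral_prod_mul (f := fun s : ℝ => W (x - s • v, x - s • v + v))
    (g := fun s : ℝ => W (x - s • w, x - s • w + w)) (Measurable.aemeasurable (by fun_prop))
    (Measurable.aemeasurable (by fun_prop))).symm

/-- A Crofton-type formula for the crossing measure of random segments. -/
lemma lintegral_throughDensity_le_crossing (hW : Measurable W) :
    ∫⁻ x, ∫⁻ v, ∫⁻ w, ‖cross v w‖ₑ * (throughDensity W x v * throughDensity W x w)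
      ≤ ((volume.withDensity W).prod (volume.withDensity W)) transversalCrossing := by
  have hO := isOpen_transversalCrossing.measurableSet
  have hind : Measurable (transversalCrossing.indicator (fun q => W q.1 * W q.2)) :=
    Measurable.indicator (by fun_prop) hO
  have hm := measurable_throughDensity hW
  have hm1 : ∀ {X : Type} [MeasurableSpace X] {f g : X → Pl}, Measurable f → Measurable g →
      Measurable fun x => throughDensity W (f x) (g x) := fun hf hg => hm.comp (hf.prodMk hg)
  have hcr : Measurable fun q : Pl × Pl => cross q.1 q.2 := continuous_cross.measurable
  rw [prod_withDensity hW hW, withDensity_apply _ hO, ← lintegral_indicator hO,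
    lintegral_prod _ hind.aemeasurable, lintegral_shear hind.lintegral_prod_right']
  rw [lintegral_lintegral_swap]
  · refine lintegral_mono fun v => ?_
    have e1 : ∀ y, ∫⁻ q, transversalCrossing.indicator (fun q => W q.1 * W q.2) ((y, y + v), q)
        = ∫⁻ w, ∫⁻ z, transversalCrossing.indicator (fun q => W q.1 * W q.2)
          ((y, y + v), (z, z + w)) := fun y =>
      lintegral_shear (F := fun q => transversalCrossing.indicator (fun q => W q.1 * W q.2)
        ((y, y + v), q)) (by fun_prop)
    simp only [e1]
    have swap₁ : ∫⁻ x, ∫⁻ w, ‖cross v w‖ₑ * (throughDensity W x v * throughDensity W x w)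
        = ∫⁻ w, ∫⁻ x, ‖cross v w‖ₑ * (throughDensity W x v * throughDensity W x w) :=
      lintegral_lintegral_swap (Measurable.aemeasurable (Measurable.mul (Measurable.enorm
        (hcr.comp (measurable_const.prodMk measurable_snd)))
        ((hm1 measurable_fst measurable_const).mul (hm1 measurable_fst measurable_snd))))
    have swap₂ : ∫⁻ y, ∫⁻ w, ∫⁻ z, transversalCrossing.indicator (fun q => W q.1 * W q.2)
          ((y, y + v), (z, z + w))
        = ∫⁻ w, ∫⁻ y, ∫⁻ z, transversalCrossing.indicator (fun q => W q.1 * W q.2)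
          ((y, y + v), (z, z + w)) :=
      lintegral_lintegral_swap (Measurable.lintegral_prod_right' (f := fun q : (Pl × Pl) × Pl =>
        transversalCrossing.indicator (fun q => W q.1 * W q.2)
          ((q.1.1, q.1.1 + v), (q.2, q.2 + q.1.2))) (by fun_prop)).aemeasurable
    rw [swap₁, swap₂]
    refine lintegral_mono fun w => ?_
    rw [lintegral_const_mul' _ _ enorm_ne_top]
    exact lintegral_crossing_of_vectors hW v w
  · refine (Measurable.lintegral_prod_right' (f := fun q : (Pl × Pl) × Pl =>
      ‖cross q.1.2 q.2‖ₑ * (throughDensity W q.1.1 q.1.2 * throughDensity W q.1.1 q.2))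
      ?_).aemeasurable
    exact Measurable.mul (Measurable.enorm (hcr.comp
      ((measurable_snd.comp measurable_fst).prodMk measurable_snd)))
      ((hm1 (by fun_prop) (by fun_prop)).mul (hm1 (by fun_prop) (by fun_prop)))

lemma pow_three_lintegral_le {α : Type*} [MeasurableSpace α] {μ : Measure α} {f : α → ℝ≥0∞}
    (hf : AEMeasurable f μ) : (∫⁻ x, f x ∂μ) ^ 3 ≤ μ univ ^ 2 * ∫⁻ x, f x ^ 3 ∂μ := by
  have hpq : (3 : ℝ).HolderConjugate (3 / 2) := by
    rw [Real.holderConjugate_iff]; norm_num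
  have := ENNReal.lintegral_mul_le_Lp_mul_Lq μ hpq hf (aemeasurable_const (b := 1))
  simp only [Pi.mul_apply, mul_one, ENNReal.one_rpow, lintegral_const, one_mul] at this
  calc (∫⁻ x, f x ∂μ) ^ 3
      ≤ ((∫⁻ x, f x ^ (3 : ℝ) ∂μ) ^ (1 / 3 : ℝ) * μ univ ^ (1 / (3 / 2) : ℝ)) ^ 3 := by gcongr
    _ = _ := by
      rw [mul_pow, ← ENNReal.rpow_natCast, ← ENNReal.rpow_natCast, ← ENNReal.rpow_mul,
        ← ENNReal.rpow_mul, mul_comm]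
      norm_num

/-- The crossing probability of two independent random segments in a convex set, with endpoint
distribution of density at most `c`. -/
theorem crossing_measure_ge {Ω : Set Pl} (hΩb : Bornology.IsBounded Ω) (hΩ : Convex ℝ Ω)
    (hW : Measurable W) {c : ℝ≥0∞} (hc : c ≠ ⊤) (hWc : ∀ q, W q ≤ c)
    (hWΩ : ∀ q, W q ≠ 0 → q.1 ∈ Ω ∧ q.2 ∈ Ω) :
    ENNReal.ofReal (8 / (9 * π ^ 2)) * (∫⁻ q, W q) ^ 3 ≤ c * volume Ω ^ 2 *
      ((volume.withDensity W).prod (volume.withDensity W)) transversalCrossing := by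
  obtain ⟨R, hR⟩ := Metric.isBounded_iff.1 hΩb
  have hm := measurable_throughDensity hW
  have hmx : ∀ x, Measurable (throughDensity W x) := fun x =>
    hm.comp (measurable_const.prodMk measurable_id)
  have hH : ∀ x v, throughDensity W x v ≠ 0 → x ∈ Ω ∧ ‖v‖ ≤ R := fun x v h => by
    by_contra hcon
    refine h ((setLIntegral_congr_fun measurableSet_Ioo fun t ht => ?_).trans lintegral_zero)
    by_contra h0
    obtain ⟨h1, h2⟩ := hWΩ _ h0
    refine hcon ⟨?_, ?_⟩
    · have := hΩ h1 h2 (a := 1 - t) (b := t) (by linarith [ht.2]) ht.1.le (by ring)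
      convert this using 1
      module
    · have := hR h2 h1
      simpa [dist_eq_norm] using this
  have hHc : ∀ x v, throughDensity W x v ≤ c := fun x v =>
    (setLIntegral_mono measurable_const fun t _ => hWc _).trans (by simp)
  have hpt : ∀ x, ENNReal.ofReal (8 / (9 * π ^ 2)) * (∫⁻ v, throughDensity W x v) ^ 3
      ≤ c * ∫⁻ v, ∫⁻ w, ‖cross v w‖ₑ * (throughDensity W x v * throughDensity W x w) := fun x => by
    have hle : volume.withDensity (throughDensity W x) ≤ c • volume := by
      rw [← withDensity_const]
      exact withDensity_mono (Eventually.of_forall (hHc x))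
    have hRx : ∀ᵐ v ∂(volume.withDensity (throughDensity W x)), ‖v‖ ≤ R := by
      rw [ae_withDensity_iff (hmx x)]
      exact Eventually.of_forall fun v hv => (hH x v hv).2
    have := busemann_plane_lintegral hc hle hRx
    rw [withDensity_apply _ MeasurableSet.univ, setLIntegral_univ] at this
    refine this.trans (le_of_eq ?_)
    congr 1
    have hcr : Measurable fun q : Pl × Pl => ‖cross q.1 q.2‖ₑ := continuous_cross.measurable.enorm
    have e1 : ∀ v, ∫⁻ w, ‖cross v w‖ₑ ∂(volume.withDensity (throughDensity W x))
        = ∫⁻ w, throughDensity W x w * ‖cross v w‖ₑ := fun v =>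
      lintegral_withDensity_eq_lintegral_mul _ (hmx x)
        (hcr.comp (measurable_const.prodMk measurable_id))
    simp only [e1]
    rw [lintegral_withDensity_eq_lintegral_mul _ (hmx x)]
    · refine lintegral_congr fun v => ?_
      rw [Pi.mul_apply, ← lintegral_const_mul]
      · refine lintegral_congr fun w => ?_
        ring
      · exact (hmx x).mul (hcr.comp (measurable_const.prodMk measurable_id))
    · exact Measurable.lintegral_prod_right' (f := fun q : Pl × Pl =>
        throughDensity W x q.2 * ‖cross q.1 q.2‖ₑ) (((hmx x).comp measurable_snd).mul hcr)
  have hM : Measurable fun x => ∫⁻ v, throughDensity W x v := hm.lintegral_prod_right'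
  have hmass : ∫⁻ q, W q = ∫⁻ x in Ω, ∫⁻ v, throughDensity W x v := by
    rw [← lintegral_throughDensity hW, setLIntegral_eq_of_support_subset]
    intro x hx
    by_contra hxΩ
    refine hx ((lintegral_congr fun v => ?_).trans lintegral_zero)
    by_contra h0
    exact hxΩ (hH x v h0).1
  calc ENNReal.ofReal (8 / (9 * π ^ 2)) * (∫⁻ q, W q) ^ 3
      ≤ ENNReal.ofReal (8 / (9 * π ^ 2)) *
        (volume Ω ^ 2 * ∫⁻ x in Ω, (∫⁻ v, throughDensity W x v) ^ 3) := by
        gcongr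
        rw [hmass]
        simpa using pow_three_lintegral_le (μ := volume.restrict Ω) hM.aemeasurable
    _ = volume Ω ^ 2 * ∫⁻ x in Ω,
        ENNReal.ofReal (8 / (9 * π ^ 2)) * (∫⁻ v, throughDensity W x v) ^ 3 := by
        rw [lintegral_const_mul' _ _ ENNReal.ofReal_ne_top]
        ring
    _ ≤ volume Ω ^ 2 * ∫⁻ x, c * ∫⁻ v, ∫⁻ w,
        ‖cross v w‖ₑ * (throughDensity W x v * throughDensity W x w) := by
        refine mul_le_mul' le_rfl ?_
        exact (setLIntegral_le_lintegral _ _).trans (lintegral_mono hpt)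
    _ ≤ _ := by
        rw [lintegral_const_mul' _ _ hc, ← mul_assoc, mul_comm (volume Ω ^ 2)]
        exact mul_le_mul' le_rfl (lintegral_throughDensity_le_crossing hW)

end throughDensity

section Counting

lemma pCross_of_mem_transversalCrossing {x₁ x₂ x₃ x₄ : Pl}
    (h : ((x₁, x₂), (x₃, x₄)) ∈ transversalCrossing) : PCross x₁ x₂ x₃ x₄ := by
  obtain ⟨h1, h2, h3, h4⟩ := h
  simp only at h1 h2 h3 h4
  have hD : cross (x₂ - x₁) (x₄ - x₃) ≠ 0 := fun h0 => by simp [h0] at h1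
  obtain ⟨D, hDdef⟩ : ∃ D, D = cross (x₂ - x₁) (x₄ - x₃) := ⟨_, rfl⟩
  obtain ⟨s, hs⟩ : ∃ s, s = cross (x₃ - x₁) (x₄ - x₃) / D := ⟨_, rfl⟩
  obtain ⟨t, ht⟩ : ∃ t, t = cross (x₃ - x₁) (x₂ - x₁) / D := ⟨_, rfl⟩
  rw [← hDdef] at h1 h2 h3 h4 hD
  have hs' : cross (x₃ - x₁) (x₄ - x₃) = s * D := by rw [hs, div_mul_cancel₀ _ hD]
  have ht' : cross (x₃ - x₁) (x₂ - x₁) = t * D := by rw [ht, div_mul_cancel₀ _ hD]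
  have hp : 0 < D ^ 2 := by positivity
  rw [hs'] at h1 h2
  rw [ht'] at h3 h4
  have e3 : ∀ s : ℝ, s * D * D = s * D ^ 2 := fun s => by ring
  rw [e3] at h1 h2 h3 h4
  rw [mul_pos_iff_of_pos_right hp] at h1 h3
  rw [mul_lt_iff_lt_one_left hp] at h2 h4
  refine ⟨(1 - s) • x₁ + s • x₂, ⟨1 - s, s, by linarith, h1, by ring, rfl⟩,
    1 - t, t, by linarith, h3, by ring, ?_⟩
  have key : D • (s • (x₂ - x₁)) = D • ((x₃ - x₁) + t • (x₄ - x₃)) := by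
    rw [smul_smul, smul_add, smul_smul, mul_comm D s, mul_comm D t, ← hs', ← ht', hDdef]
    ext <;> simp [cross] <;> ring
  have key2 := smul_right_injective Pl hD key
  ext
  · have := congrArg Prod.fst key2
    simp at this ⊢
    linarith
  · have := congrArg Prod.snd key2
    simp at this ⊢
    linarith

lemma crNumPl_nonneg {V : Type*} (G : SimpleGraph V) (p : V → Pl) : 0 ≤ crNumPl G p := by
  unfold crNumPl; positivity

variable {V : Type*} [Fintype V]

open Classical in
/-- The oriented edges of a finite graph. -/
def orientedEdges (G : SimpleGraph V) : Finset (V × V) :=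
  Finset.univ.filter fun d => G.Adj d.1 d.2

lemma card_orientedEdges (G : SimpleGraph V) :
    (orientedEdges G).card = 2 * G.edgeSet.ncard := by
  classical
  rw [Set.ncard_eq_toFinset_card', SimpleGraph.edgeFinset.eq_1 G |>.symm,
    ← SimpleGraph.sum_degrees_eq_twice_card_edges, orientedEdges, Finset.card_filter,
    ← Finset.univ_product_univ, Finset.sum_product]
  refine Finset.sum_congr rfl fun v _ => ?_
  rw [← Finset.card_filter, ← SimpleGraph.card_neighborFinset_eq_degree]
  congr 1
  ext w
  simp

open Classical in
/-- The number of transversally crossing pairs of oriented edges is at most eight times the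
crossing number. -/
lemma card_crossing_le (G : SimpleGraph V) (p : V → Pl) :
    (((orientedEdges G ×ˢ orientedEdges G).filter fun q =>
      (Prod.map p p q.1, Prod.map p p q.2) ∈ transversalCrossing).card : ℝ) ≤ 8 * crNumPl G p := by
  set S : Set (Sym2 V × Sym2 V) := {q |
      q.1 ∈ G.edgeSet ∧ q.2 ∈ G.edgeSet ∧ q.1 ≠ q.2 ∧ DrawnCrossPl p q.1 q.2} with hS
  have hSf : S.Finite := S.toFinite
  have key := Finset.card_le_mul_card_image_of_maps_to
    (s := (orientedEdges G ×ˢ orientedEdges G).filter fun q =>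
      (Prod.map p p q.1, Prod.map p p q.2) ∈ transversalCrossing)
    (t := hSf.toFinset) (f := fun q : (V × V) × (V × V) => (s(q.1.1, q.1.2), s(q.2.1, q.2.2)))
    ?_ 4 ?_
  · have h2 : S.ncard = hSf.toFinset.card := Set.ncard_eq_toFinset_card S hSf
    rw [← h2] at key
    have : (8 : ℝ) * crNumPl G p = ((4 * S.ncard : ℕ) : ℝ) := by
      rw [crNumPl]; push_cast; ring
    rw [this]
    exact_mod_cast key
  · rintro ⟨⟨u, v⟩, ⟨u', v'⟩⟩ hq
    simp only [orientedEdges, Finset.mem_filter, Finset.mem_product, Finset.mem_univ, true_and,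
      Prod.map_apply] at hq
    obtain ⟨⟨h1, h2⟩, h3⟩ := hq
    rw [Set.Finite.mem_toFinset, hS]
    refine ⟨h1, h2, ?_, u, v, u', v', by simp, by simp, h1.ne, by simp, by simp, h2.ne,
      pCross_of_mem_transversalCrossing h3⟩
    intro heq
    have h4 := h3.1
    simp only [Sym2.eq, Sym2.rel_iff', Prod.mk.injEq, Prod.swap_prod_mk] at heq
    rcases heq with ⟨rfl, rfl⟩ | ⟨rfl, rfl⟩
    · simp [cross, mul_comm] at h4
    · have : cross (p v - p u) (p u - p v) = 0 := by simp [cross]; ring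
      simp [this] at h4
  · rintro ⟨a, b⟩ -
    induction a with | h u v
    induction b with | h u' v'
    refine (Finset.card_le_card (t := {(u, v), (v, u)} ×ˢ {(u', v'), (v', u')}) ?_).trans ?_
    · rintro ⟨⟨x, y⟩, ⟨x', y'⟩⟩ hq
      have := (Finset.mem_filter.1 hq).2
      simp only [Prod.mk.injEq, Sym2.eq, Sym2.rel_iff', Prod.swap_prod_mk] at this
      simpa using this
    · rw [Finset.card_product]
      exact Nat.mul_le_mul Finset.card_le_two Finset.card_le_two

lemma crNumPl_le (G : SimpleGraph V) (p : V → Pl) :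
    crNumPl G p ≤ (Fintype.card V : ℝ) ^ 4 := by
  classical
  have h1 : Fintype.card (Sym2 V) ≤ Fintype.card (V × V) :=
    Fintype.card_le_of_surjective (fun q : V × V => s(q.1, q.2)) fun a => by
      induction a with | h u v
      exact ⟨(u, v), rfl⟩
  have h2 : {q : Sym2 V × Sym2 V | q.1 ∈ G.edgeSet ∧ q.2 ∈ G.edgeSet ∧ q.1 ≠ q.2 ∧
      DrawnCrossPl p q.1 q.2}.ncard ≤ Fintype.card V ^ 4 := by
    refine (Set.ncard_le_ncard (Set.subset_univ _)).trans ?_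
    rw [Set.ncard_univ, Nat.card_eq_fintype_card, Fintype.card_prod]
    refine (Nat.mul_le_mul h1 h1).trans_eq ?_
    rw [Fintype.card_prod]; ring
  have h3 : (({q : Sym2 V × Sym2 V | q.1 ∈ G.edgeSet ∧ q.2 ∈ G.edgeSet ∧ q.1 ≠ q.2 ∧
      DrawnCrossPl p q.1 q.2}.ncard : ℕ) : ℝ) ≤ (Fintype.card V : ℝ) ^ 4 := by exact_mod_cast h2
  unfold crNumPl
  have : (0 : ℝ) ≤ (Fintype.card V : ℝ) ^ 4 := by positivity
  linarith

end Counting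

section EmpiricalMeasure

variable {ι κ E F : Type*} [MeasurableSpace E] [MeasurableSpace F]

/-- The uniform distribution on the family of points `f i`, `i ∈ s`. -/
def empirical (s : Finset ι) (f : ι → E) : Measure E :=
  (s.card : ℝ≥0∞)⁻¹ • ∑ i ∈ s, Measure.dirac (f i)

lemma lintegral_empirical (s : Finset ι) (f : ι → E) {g : E → ℝ≥0∞} (hg : Measurable g) :
    ∫⁻ x, g x ∂(empirical s f) = (s.card : ℝ≥0∞)⁻¹ * ∑ i ∈ s, g (f i) := by
  simp [empirical, lintegral_finsetSum_measure, lintegral_dirac' _ hg]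

lemma isProbabilityMeasure_empirical {s : Finset ι} (hs : s.Nonempty) (f : ι → E) :
    IsProbabilityMeasure (empirical s f) := by
  constructor
  rw [← lintegral_one, lintegral_empirical s f measurable_const]
  simp only [Finset.sum_const, nsmul_eq_mul, mul_one]
  exact ENNReal.inv_mul_cancel (by simp [hs.ne_empty]) (ENNReal.natCast_ne_top _)

lemma integral_empirical [TopologicalSpace E] [OpensMeasurableSpace E]
    (s : Finset ι) (f : ι → E) {g : E → ℝ} (hg : Continuous g) :
    ∫ x, g x ∂(empirical s f) = 1 / (s.card : ℝ) * ∑ i ∈ s, g (f i) := by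
  have hm : StronglyMeasurable g := hg.measurable.stronglyMeasurable
  rw [empirical, integral_smul_measure, integral_finsetSum_measure]
  · simp [integral_dirac' _ _ hm]
  · exact fun i _ => integrable_dirac' hm (by simp)

lemma empirical_prod_apply (s : Finset ι) (t : Finset κ) (f : ι → E) (g : κ → F)
    [SFinite (empirical t g)] {A : Set (E × F)} (hA : MeasurableSet A) :
    ((empirical s f).prod (empirical t g)) A
      = (s.card : ℝ≥0∞)⁻¹ * ((t.card : ℝ≥0∞)⁻¹ *
        ∑ q ∈ s ×ˢ t, A.indicator 1 (f q.1, g q.2)) := by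
  rw [← lintegral_indicator_one hA, lintegral_prod _ (measurable_one.indicator hA).aemeasurable,
    lintegral_empirical _ _ (measurable_one.indicator hA).lintegral_prod_right']
  congr 1
  rw [Finset.sum_product, Finset.mul_sum]
  refine Finset.sum_congr rfl fun i _ => ?_
  rw [lintegral_empirical]
  exact (measurable_one.indicator hA).comp measurable_prodMk_left

end EmpiricalMeasure

section WeakLimit

/-- Domination of measures passes to weak limits. -/
lemma le_smul_of_tendsto {ι E : Type*} [TopologicalSpace E]
    [TopologicalSpace.PseudoMetrizableSpace E] [MeasurableSpace E] [BorelSpace E]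
    {L : Filter ι} [L.NeBot]
    {P Q : ι → ProbabilityMeasure E} {P₀ Q₀ : ProbabilityMeasure E}
    {c : ι → ℝ≥0∞} {c₀ : ℝ≥0∞} (hP : Tendsto P L (𝓝 P₀)) (hQ : Tendsto Q L (𝓝 Q₀))
    (hc : Tendsto c L (𝓝 c₀)) (hc₀ : c₀ ≠ ⊤)
    (hle : ∀ᶠ i in L, (P i : Measure E) ≤ c i • (Q i : Measure E)) :
    (P₀ : Measure E) ≤ c₀ • (Q₀ : Measure E) := by
  have hclosed : ∀ A : Set E, IsClosed A → (P₀ : Measure E) A ≤ c₀ * (Q₀ : Measure E) A := by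
    intro A hA
    have h1 : ∀ k, (P₀ : Measure E) A ≤ c₀ * ∫⁻ x, hA.apprSeq k x ∂(Q₀ : Measure E) := fun k => by
      refine (HasOuterApproxClosed.measure_le_lintegral hA P₀.1 k).trans ?_
      · refine le_of_tendsto_of_tendsto
          (ProbabilityMeasure.tendsto_iff_forall_lintegral_tendsto.1 hP (hA.apprSeq k))
          (ENNReal.Tendsto.mul hc (Or.inr ?_)
            (ProbabilityMeasure.tendsto_iff_forall_lintegral_tendsto.1 hQ (hA.apprSeq k))
            (Or.inr hc₀)) ?_
        · exact (BoundedContinuousFunction.lintegral_lt_top_of_nnreal _ _).ne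
        · filter_upwards [hle] with i hi
          refine (lintegral_mono' hi le_rfl).trans_eq ?_
          rw [lintegral_smul_measure, smul_eq_mul]
    refine ge_of_tendsto (x := atTop) (ENNReal.Tendsto.const_mul (a := c₀)
      (HasOuterApproxClosed.tendsto_lintegral_apprSeq hA (Q₀ : Measure E)) (Or.inr hc₀))
      (Eventually.of_forall h1)
  refine Measure.le_iff.2 fun A hA => ?_
  rw [hA.measure_eq_iSup_isClosed_of_ne_top (measure_ne_top _ _)]
  refine iSup_le fun K => iSup_le fun hK => iSup_le fun hKc => ?_
  refine (hclosed K hKc).trans ?_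
  rw [Measure.smul_apply, smul_eq_mul]
  gcongr

/-- The crossing probability of two independent random segments in `Ω` whose endpoint distribution
is dominated by a multiple of the uniform one. -/
theorem crossing_probability_ge {Ω : Set Pl} (hΩc : IsCompact Ω) (hΩ : Convex ℝ Ω)
    (hΩ₀ : volume Ω ≠ 0) {P : Measure (Pl × Pl)} [IsProbabilityMeasure P] {c : ℝ≥0∞} (hc : c ≠ ⊤)
    (hP : P ≤ c • (unifOn Ω).prod (unifOn Ω)) :
    ENNReal.ofReal (8 / (9 * π ^ 2)) ≤ c * (P.prod P) transversalCrossing := by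
  have hfin : volume Ω ≠ ⊤ := hΩc.measure_lt_top.ne
  have hS : MeasurableSet (Ω ×ˢ Ω) := hΩc.measurableSet.prod hΩc.measurableSet
  obtain ⟨k, hk⟩ : ∃ k, k = c * ((volume Ω)⁻¹ * (volume Ω)⁻¹) := ⟨_, rfl⟩
  have hk' : k ≠ ⊤ := by
    rw [hk]
    exact ENNReal.mul_ne_top hc (ENNReal.mul_ne_top (ENNReal.inv_ne_top.2 hΩ₀)
      (ENNReal.inv_ne_top.2 hΩ₀))
  obtain ⟨ν, hν⟩ : ∃ ν : Measure (Pl × Pl), ν = k • volume.restrict (Ω ×ˢ Ω) := ⟨_, rfl⟩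
  have hνP : P ≤ ν := by
    convert hP using 1
    rw [hν, unifOn, Measure.prod_smul_left, Measure.prod_smul_right, Measure.prod_restrict,
      ← Measure.volume_eq_prod, smul_smul, smul_smul, hk]
    ring_nf
  have : IsFiniteMeasure ν := by
    constructor
    rw [hν, Measure.smul_apply, Measure.restrict_apply_univ, smul_eq_mul, Measure.volume_eq_prod,
      Measure.prod_prod]
    exact ENNReal.mul_lt_top hk'.lt_top (ENNReal.mul_lt_top hfin.lt_top hfin.lt_top)
  obtain ⟨W, hWdef⟩ : ∃ W : Pl × Pl → ℝ≥0∞,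
      W = (Ω ×ˢ Ω).indicator (fun q => k * min (P.rnDeriv ν q) 1) := ⟨_, rfl⟩
  have hW : Measurable W := by
    rw [hWdef]
    exact Measurable.indicator
      (((Measure.measurable_rnDeriv P ν).min measurable_const).const_mul k) hS
  have hPW : P = volume.withDensity W := by
    have h1 : P = ν.withDensity (fun q => min (P.rnDeriv ν q) 1) := by
      conv_lhs => rw [← Measure.withDensity_rnDeriv_eq P ν (Measure.absolutelyContinuous_of_le hνP)]
      refine withDensity_congr_ae ?_
      filter_upwards [Measure.rnDeriv_le_one_of_le hνP] with q hq
      exact (min_eq_left hq).symm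
    rw [h1, hWdef, withDensity_indicator hS]
    change _ = (volume.restrict (Ω ×ˢ Ω)).withDensity (k • fun q => min (P.rnDeriv ν q) 1)
    rw [withDensity_smul' _ _ hk', ← withDensity_smul_measure, ← hν]
  have hmass : ∫⁻ q, W q = 1 := by
    rw [← setLIntegral_univ, ← withDensity_apply _ MeasurableSet.univ, ← hPW, measure_univ]
  have key := crossing_measure_ge hΩc.isBounded hΩ hW hk' (fun q => ?_) (fun q hq => ?_)
  · rw [hmass, one_pow, mul_one, ← hPW] at key
    refine key.trans (le_of_eq ?_)
    congr 1
    rw [hk, mul_assoc, sq, mul_mul_mul_comm, ENNReal.inv_mul_cancel hΩ₀ hfin, mul_one, mul_one]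
  · rw [hWdef]
    exact (indicator_le_self _ _ q).trans (mul_le_of_le_one_right' (min_le_right _ _))
  · rw [hWdef] at hq
    exact (mem_of_indicator_ne_zero hq : q ∈ Ω ×ˢ Ω)

end WeakLimit

section Drawings

/-- Any subsequential bound on the normalized crossing numbers of a uniform sequence of drawings
is at least the asserted constant. -/
lemma le_of_frequently_crossing_le {Ω : Set Pl} (hΩc : IsCompact Ω) (hΩ : Convex ℝ Ω)
    (hΩ₀ : volume Ω ≠ 0) [IsProbabilityMeasure (unifOn Ω)]
    (G : ∀ n : ℕ, SimpleGraph (Fin n)) (p : ∀ n : ℕ, Fin n → Pl) (hmem : ∀ n v, p n v ∈ Ω)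
    (huniform : ∀ F : Pl → ℝ, Continuous F →
      Tendsto (fun n : ℕ => (1 / (n : ℝ)) * ∑ v, F (p n v)) atTop (𝓝 (∫ x, F x ∂(unifOn Ω))))
    {e : ℝ} (he : 0 ≤ e)
    (hdens : Tendsto (fun n : ℕ => ((G n).edgeSet.ncard : ℝ) / (n : ℝ) ^ 2) atTop (𝓝 e))
    {b : ℝ} (hb : ∃ᶠ n : ℕ in atTop, crNumPl (G n) (p n) / (n : ℝ) ^ 4 ≤ b) :
    8 / (9 * π ^ 2) * e ^ 3 ≤ b := by
  classical
  have hb₀ : 0 ≤ b := by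
    obtain ⟨n, hn⟩ := hb.exists
    exact (div_nonneg (crNumPl_nonneg _ _) (by positivity)).trans hn
  rcases he.eq_or_lt with rfl | he
  · simpa using hb₀
  have hne : (atTop ⊓ 𝓟 {n : ℕ | crNumPl (G n) (p n) / (n : ℝ) ^ 4 ≤ b}).NeBot :=
    frequently_mem_iff_neBot.1 hb
  obtain ⟨U, hU⟩ := Ultrafilter.exists_le
    (atTop ⊓ 𝓟 {n : ℕ | crNumPl (G n) (p n) / (n : ℝ) ^ 4 ≤ b})
  have hUtop : (U : Filter ℕ) ≤ atTop := hU.trans inf_le_left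
  have hUb : ∀ᶠ n in (U : Filter ℕ), crNumPl (G n) (p n) / (n : ℝ) ^ 4 ≤ b :=
    le_principal_iff.1 (hU.trans inf_le_right)
  have hn₀ : ∀ᶠ n in (U : Filter ℕ), 0 < n := hUtop (eventually_gt_atTop 0)
  have hm₀ : ∀ᶠ n in (U : Filter ℕ), 0 < (G n).edgeSet.ncard := by
    filter_upwards [hUtop (hdens.eventually (lt_mem_nhds he))] with n hn
    by_contra h0
    simp [Nat.eq_zero_of_not_pos h0] at hn
  -- the empirical vertex and edge distributions
  have hΛex : ∀ n, ∃ μ : ProbabilityMeasure Pl, 0 < n →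
      (μ : Measure Pl) = empirical Finset.univ (p n) := fun n => by
    by_cases h : 0 < n
    · have : Nonempty (Fin n) := ⟨⟨0, h⟩⟩
      exact ⟨⟨_, isProbabilityMeasure_empirical Finset.univ_nonempty (p n)⟩, fun _ => rfl⟩
    · exact ⟨⟨Measure.dirac 0, inferInstance⟩, fun h' => absurd h' h⟩
  have hPex : ∀ n, ∃ μ : ProbabilityMeasure (Pl × Pl), 0 < (G n).edgeSet.ncard →
      (μ : Measure (Pl × Pl)) = empirical (orientedEdges (G n)) (Prod.map (p n) (p n)) :=
      fun n => by
    by_cases h : 0 < (G n).edgeSet.ncard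
    · have : (orientedEdges (G n)).Nonempty := by
        rw [← Finset.card_pos, card_orientedEdges]; omega
      exact ⟨⟨_, isProbabilityMeasure_empirical this _⟩, fun _ => rfl⟩
    · exact ⟨⟨Measure.dirac 0, inferInstance⟩, fun h' => absurd h' h⟩
  choose Λ hΛ using hΛex
  choose P hP using hPex
  let Λ₀ : ProbabilityMeasure Pl := ⟨unifOn Ω, inferInstance⟩
  have hΛlim : Tendsto Λ U (𝓝 Λ₀) := by
    rw [ProbabilityMeasure.tendsto_iff_forall_integral_tendsto]
    intro f
    refine ((huniform f f.continuous).mono_left hUtop).congr' ?_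
    filter_upwards [hn₀] with n hn
    rw [hΛ n hn, integral_empirical _ _ f.continuous, Finset.card_univ, Fintype.card_fin]
  have hΛ2 : Tendsto (fun n => (Λ n).prod (Λ n)) U (𝓝 (Λ₀.prod Λ₀)) :=
    (ProbabilityMeasure.continuous_prod.tendsto (Λ₀, Λ₀)).comp (hΛlim.prodMk_nhds hΛlim)
  obtain ⟨P₀, hPlim⟩ : ∃ P₀, Tendsto P U (𝓝 P₀) := by
    have hcomp := isCompact_setOfPred_probabilityMeasure_mass_eq_compl_isCompact_le
      (E := Pl × Pl) (u := fun _ => 0) (K := fun _ => Ω ×ˢ Ω) tendsto_const_nhds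
      (fun _ => hΩc.prod hΩc) (Or.inl inferInstance)
    obtain ⟨P₀, -, h⟩ := hcomp.ultrafilter_le_nhds (U.map P) (by
      rw [le_principal_iff]
      change ∀ᶠ n in (U : Filter ℕ), ∀ _ : ℕ, P n (Ω ×ˢ Ω)ᶜ ≤ 0
      filter_upwards [hm₀] with n hn _
      rw [← ENNReal.coe_le_coe, ProbabilityMeasure.ennreal_coeFn_eq_coeFn_toMeasure, hP n hn,
        ← lintegral_indicator_one (hΩc.prod hΩc).measurableSet.compl, lintegral_empirical _ _
          (measurable_one.indicator (hΩc.prod hΩc).measurableSet.compl)]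
      simp [Prod.map, hmem])
    exact ⟨P₀, h⟩
  have hdU := hdens.mono_left hUtop
  have hdom : (P₀ : Measure (Pl × Pl)) ≤
      ENNReal.ofReal (1 / (2 * e)) • (unifOn Ω).prod (unifOn Ω) := by
    refine le_smul_of_tendsto (Q₀ := Λ₀.prod Λ₀)
      (c := fun n => ENNReal.ofReal (1 / (2 * (((G n).edgeSet.ncard : ℝ) / (n : ℝ) ^ 2))))
      hPlim hΛ2 (ENNReal.tendsto_ofReal (Tendsto.div tendsto_const_nhds (hdU.const_mul 2)
        (by positivity)))
      ENNReal.ofReal_ne_top ?_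
    filter_upwards [hn₀, hm₀] with n hn hm
    have hnR : (0 : ℝ) < n := by exact_mod_cast hn
    have hmR : (0 : ℝ) < (G n).edgeSet.ncard := by exact_mod_cast hm
    refine Measure.le_iff.2 fun A hA => ?_
    rw [Measure.smul_apply, ProbabilityMeasure.toMeasure_prod, hP n hm]
    change _ ≤ _ * (((Λ n : Measure Pl)).prod (Λ n : Measure Pl)) A
    have hsf : SFinite (empirical Finset.univ (p n)) := by rw [← hΛ n hn]; infer_instance
    rw [hΛ n hn, empirical_prod_apply _ _ _ _ hA, ← lintegral_indicator_one hA,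
      lintegral_empirical _ _ (measurable_one.indicator hA), card_orientedEdges,
      Finset.card_univ, Fintype.card_fin, ← mul_assoc, ← mul_assoc]
    refine mul_le_mul' (le_of_eq ?_) ?_
    · rw [← ENNReal.ofReal_natCast, ← ENNReal.ofReal_natCast n,
        ← ENNReal.ofReal_inv_of_pos (by push_cast; positivity),
        ← ENNReal.ofReal_inv_of_pos hnR, ← ENNReal.ofReal_mul (by positivity),
        ← ENNReal.ofReal_mul (by positivity)]
      congr 1
      push_cast
      field_simp
    · exact Finset.sum_le_sum_of_subset fun q _ => by simp
  have hcount : ∀ᶠ n in (U : Filter ℕ),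
      ((P n).prod (P n) : Measure ((Pl × Pl) × (Pl × Pl))) transversalCrossing
        ≤ ENNReal.ofReal (2 * b / (((G n).edgeSet.ncard : ℝ) / (n : ℝ) ^ 2) ^ 2) := by
    filter_upwards [hn₀, hm₀, hUb] with n hn hm hbn
    have hnR : (0 : ℝ) < n := by exact_mod_cast hn
    have hmR : (0 : ℝ) < (G n).edgeSet.ncard := by exact_mod_cast hm
    have hsf : SFinite (empirical (orientedEdges (G n)) (Prod.map (p n) (p n))) := by
      rw [← hP n hm]; infer_instance
    rw [ProbabilityMeasure.toMeasure_prod, hP n hm,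
      empirical_prod_apply _ _ _ _ isOpen_transversalCrossing.measurableSet]
    have hc := card_crossing_le (G n) (p n)
    rw [Finset.card_filter] at hc
    have e1 : ∑ q ∈ orientedEdges (G n) ×ˢ orientedEdges (G n),
        transversalCrossing.indicator (1 : (Pl × Pl) × (Pl × Pl) → ℝ≥0∞)
          (Prod.map (p n) (p n) q.1, Prod.map (p n) (p n) q.2)
        ≤ ENNReal.ofReal (8 * crNumPl (G n) (p n)) := by
      refine le_trans (le_of_eq ?_) (ENNReal.ofReal_le_ofReal hc)
      rw [ENNReal.ofReal_natCast]
      push_cast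
      refine Finset.sum_congr rfl fun q _ => ?_
      rw [indicator_apply]
      rfl
    refine (mul_le_mul' le_rfl (mul_le_mul' le_rfl e1)).trans ?_
    rw [card_orientedEdges, ← ENNReal.ofReal_natCast,
      ← ENNReal.ofReal_inv_of_pos (by push_cast; positivity), ← ENNReal.ofReal_mul (by positivity),
      ← ENNReal.ofReal_mul (by positivity)]
    refine ENNReal.ofReal_le_ofReal ?_
    rw [div_le_iff₀ (by positivity)] at hbn
    calc _ = 2 * crNumPl (G n) (p n) / ((G n).edgeSet.ncard : ℝ) ^ 2 := by
          push_cast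
          field_simp
          ring
      _ ≤ 2 * (b * (n : ℝ) ^ 4) / ((G n).edgeSet.ncard : ℝ) ^ 2 := by gcongr
      _ = _ := by field_simp
  have hopen : ((P₀.prod P₀ : ProbabilityMeasure _) : Measure ((Pl × Pl) × (Pl × Pl)))
      transversalCrossing ≤ ENNReal.ofReal (2 * b / e ^ 2) := by
    have hP2 : Tendsto (fun n => (P n).prod (P n)) U (𝓝 (P₀.prod P₀)) :=
      (ProbabilityMeasure.continuous_prod.tendsto (P₀, P₀)).comp (hPlim.prodMk_nhds hPlim)
    refine (ProbabilityMeasure.le_liminf_measure_open_of_tendsto hP2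
      isOpen_transversalCrossing).trans ?_
    have hlim : Tendsto (fun n : ℕ => ENNReal.ofReal
        (2 * b / (((G n).edgeSet.ncard : ℝ) / (n : ℝ) ^ 2) ^ 2)) U
        (𝓝 (ENNReal.ofReal (2 * b / e ^ 2))) :=
      ENNReal.tendsto_ofReal (tendsto_const_nhds.div (hdU.pow 2) (by positivity))
    rw [← hlim.liminf_eq]
    exact liminf_le_liminf hcount
  rw [ProbabilityMeasure.toMeasure_prod] at hopen
  have key := (crossing_probability_ge hΩc hΩ hΩ₀ ENNReal.ofReal_ne_top hdom).trans
    (mul_le_mul' le_rfl hopen)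
  rw [← ENNReal.ofReal_mul (by positivity), ENNReal.ofReal_le_ofReal_iff (by positivity)] at key
  calc 8 / (9 * π ^ 2) * e ^ 3 ≤ 1 / (2 * e) * (2 * b / e ^ 2) * e ^ 3 := by gcongr
    _ = b := by field_simp

end Drawings

/-- **Crossing numbers of uniform straight-line drawings in a convex domain.**
Let `Ω ⊂ ℝ²` be compact convex with nonempty interior, let `D_n = (G_n, p_n)` be a
uniform sequence of good straight-line drawings in `Ω` with `|V(G_n)| = n` and
`|E(G_n)|/n² → e`.  Then `liminf cr(D_n)/n⁴ ≥ (8/(9π²)) e³`. -/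
theorem uniform_planar_drawing_crossing
    (Ω : Set Pl) (hΩc : IsCompact Ω) (hΩconv : Convex ℝ Ω)
    (hΩint : (interior Ω).Nonempty)
    (G : ∀ n : ℕ, SimpleGraph (Fin n)) (p : ∀ n : ℕ, Fin n → Pl)
    (hmem : ∀ n v, p n v ∈ Ω)
    (hinj : ∀ n, Function.Injective (p n))
    (hgood₁ : ∀ n u v z, (G n).Adj u v → p n z ∉ openSegment ℝ (p n u) (p n v))
    (hgood₂ : ∀ n u v u' v', (G n).Adj u v → (G n).Adj u' v' →
      (s(u, v) : Sym2 (Fin n)) ≠ s(u', v') →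
      (segment ℝ (p n u) (p n v) ∩ segment ℝ (p n u') (p n v')).Finite)
    (hgood₃ : ∀ (n : ℕ) (u v u' v' u'' v'' : Fin n),
      (G n).Adj u v → (G n).Adj u' v' → (G n).Adj u'' v'' →
      (s(u, v) : Sym2 (Fin n)) ≠ s(u', v') →
      (s(u, v) : Sym2 (Fin n)) ≠ s(u'', v'') →
      (s(u', v') : Sym2 (Fin n)) ≠ s(u'', v'') →
      ¬ (openSegment ℝ (p n u) (p n v) ∩ openSegment ℝ (p n u') (p n v') ∩
          openSegment ℝ (p n u'') (p n v'')).Nonempty)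
    (huniform : ∀ F : Pl → ℝ, Continuous F →
      Tendsto (fun n : ℕ => (1 / (n : ℝ)) * ∑ v, F (p n v)) atTop
        (𝓝 (∫ x, F x ∂(unifOn Ω))))
    (e : ℝ)
    (hdens : Tendsto (fun n : ℕ => ((G n).edgeSet.ncard : ℝ) / (n : ℝ) ^ 2)
      atTop (𝓝 e)) :
    8 / (9 * π ^ 2) * e ^ 3 ≤
      Filter.liminf (fun n : ℕ => crNumPl (G n) (p n) / (n : ℝ) ^ 4) atTop := by
  have hΩ₀ : volume Ω ≠ 0 := (Measure.measure_pos_of_nonempty_interior volume hΩint).ne'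
  have : IsProbabilityMeasure (unifOn Ω) := by
    constructor
    rw [unifOn, Measure.smul_apply, Measure.restrict_apply_univ, smul_eq_mul]
    exact ENNReal.inv_mul_cancel hΩ₀ hΩc.measure_lt_top.ne
  have he : 0 ≤ e := ge_of_tendsto' hdens fun n => by positivity
  have hcob : IsCoboundedUnder (· ≥ ·) atTop
      fun n : ℕ => crNumPl (G n) (p n) / (n : ℝ) ^ 4 := by
    refine IsBoundedUnder.isCoboundedUnder_ge (isBoundedUnder_of ⟨1, fun n => ?_⟩)
    have := crNumPl_le (G n) (p n)
    rw [Fintype.card_fin] at this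
    exact div_le_one_of_le₀ this (by positivity)
  refine le_of_forall_lt fun b hb => ?_
  obtain ⟨b', hb, hb'⟩ := exists_between hb
  refine hb.trans_le ?_
  refine le_liminf_of_le hcob ?_
  by_contra hcon
  rw [not_eventually] at hcon
  refine hb'.not_ge (le_of_frequently_crossing_le hΩc hΩconv hΩ₀ G p hmem huniform he hdens
    (hcon.mono fun n hn => (not_le.1 hn).le))
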